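/- Assume Hypotheses 1–3. Then: (1) for every (x,y) ∈ 𝕏 × ℝ the limit V(x,y) := lim_{n→∞} (σ√(2πn)/2)·ℙ_x(τ_y > n) exists in [0,∞) (equivalently, √n·ℙ_x(τ_y > n) → 2V(x,y)/(√(2π)σ) as n → ∞); (2) there exists c > 0 such that for all (x,y) ∈ 𝕏 × ℝ and n ≥ 1, ℙ_x(τ_y > n) ≤ c(1 + max(y,0))/√n. -/

import Mathlib

open Finset Filter Real Topology MeasureTheory

namespace CLLT

variable {X : Type*}

/-- Product of the transition weights along a path. -/
noncomputable def wt (P : X → X → ℝ) : X → List X → ℝ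
  | _, [] => 1
  | x, y :: ys => P x y * wt P y ys

/-- Extension of a finite path `X₁, …, Xₙ` to a trajectory `ℕ → X` with `X₀ = x`
(values beyond time `n` are irrelevant and set to `x`). -/
def pathExt (x : X) {n : ℕ} (path : Fin n → X) : ℕ → X := fun k =>
  if h : 1 ≤ k ∧ k ≤ n then path ⟨k - 1, by omega⟩ else x

/-- Expectation `𝔼_x (F (X₀, X₁, …))` of a functional of the first `n` steps of the
Markov chain with transition kernel `P` started at `X₀ = x`. -/
noncomputable def Ex [Fintype X] (P : X → X → ℝ) (x : X) (n : ℕ)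
    (F : (ℕ → X) → ℝ) : ℝ :=
  ∑ path : Fin n → X, wt P x (List.ofFn path) * F (pathExt x path)

open Classical in
/-- Real-valued indicator of a proposition. -/
noncomputable def ind (p : Prop) : ℝ := if p then 1 else 0

/-- Partial sum `S_k = f(X₁) + ⋯ + f(X_k)` along a trajectory. -/
noncomputable def Spath (f : X → ℝ) (ω : ℕ → X) (k : ℕ) : ℝ :=
  ∑ i ∈ Finset.Icc 1 k, f (ω i)

/-- The event `τ_y > n`, i.e. `y + S_k > 0` for all `k = 1, …, n`. -/
def survives (f : X → ℝ) (y : ℝ) (n : ℕ) (ω : ℕ → X) : Prop :=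
  ∀ k ∈ Finset.Icc 1 n, 0 < y + Spath f ω k

/-- `n`-step transition kernel. -/
noncomputable def kpow [Fintype X] [DecidableEq X] (P : X → X → ℝ) : ℕ → X → X → ℝ
  | 0 => fun x x' => if x = x' then 1 else 0
  | n + 1 => fun x x' => ∑ y, P x y * kpow P n y x'

/-- Transition operator acting on functions. -/
noncomputable def Pop [Fintype X] (P : X → X → ℝ) (g : X → ℝ) (x : X) : ℝ :=
  ∑ x', P x x' * g x'

/-- Asymptotic variance `σ² = ν(f²) + 2 ∑_{n ≥ 1} ν(f ⬝ Pⁿ f)`. -/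
noncomputable def sigma2 [Fintype X] (P : X → X → ℝ) (ν f : X → ℝ) : ℝ :=
  (∑ x, f x ^ 2 * ν x) + 2 * ∑' n : ℕ, ∑ x, f x * ((Pop P)^[n + 1] f) x * ν x

/-- Hypothesis 1 (primitivity). -/
def Primitive [Fintype X] [DecidableEq X] (P : X → X → ℝ) : Prop :=
  ∃ k₀ : ℕ, 1 ≤ k₀ ∧ ∀ x x', 0 < kpow P k₀ x x'

/-- Hypothesis 3 (non-lattice condition). -/
def NonLattice [Fintype X] (P : X → X → ℝ) (f : X → ℝ) : Prop :=
  ∀ θ a : ℝ, ∃ (n : ℕ) (g : Fin (n + 1) → X),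
    (0 < ∏ i : Fin (n + 1), P (g i) (g (i + 1))) ∧
    ∀ m : ℤ, (∑ i, f (g i)) - (n + 1 : ℝ) * θ ≠ a * (m : ℝ)

/-- `P` is a stochastic matrix and `ν` is a positive invariant probability for it. -/
structure IsStochastic [Fintype X] (P : X → X → ℝ) (ν : X → ℝ) : Prop where
  nonneg : ∀ x x', 0 ≤ P x x'
  rowSum : ∀ x, ∑ x', P x x' = 1
  nuPos : ∀ x, 0 < ν x
  nuSum : ∑ x, ν x = 1
  nuInv : ∀ x', ∑ x, ν x * P x x' = ν x'

/-- Dual kernel `P*(x, x') = ν(x') P(x', x) / ν(x)`. -/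
noncomputable def dualK (P : X → X → ℝ) (ν : X → ℝ) (x x' : X) : ℝ :=
  ν x' * P x' x / ν x

/-- Sup norm of a function on a finite set. -/
noncomputable def supN [Fintype X] [Nonempty X] (ψ : X → ℝ) : ℝ := ⨆ x, |ψ x|

/-- Rayleigh density `φ₊(t) = t e^{-t²/2} 𝟙_{t ≥ 0}`. -/
noncomputable def rayleigh (t : ℝ) : ℝ := if 0 ≤ t then t * Real.exp (-t ^ 2 / 2) else 0

/-- Centred normal density with standard deviation `s`. -/
noncomputable def gauss (s u : ℝ) : ℝ :=
  Real.exp (-u ^ 2 / (2 * s ^ 2)) / (s * Real.sqrt (2 * π))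

/-- Perturbed transition operator `P_t`, as a complex matrix. -/
noncomputable def Pmat [Fintype X] (P : X → X → ℝ) (f : X → ℝ) (t : ℝ) : Matrix X X ℂ :=
  Matrix.of fun x x' => (P x x' : ℂ) * Complex.exp (Complex.I * (t : ℂ) * (f x' : ℂ))

/-- A complex matrix viewed as a continuous linear operator on `X → ℂ`
(equipped with the sup norm). -/
noncomputable def toCLM [Fintype X] (M : Matrix X X ℂ) : (X → ℂ) →L[ℂ] (X → ℂ) :=
  LinearMap.toContinuousLinearMap M.mulVecLin

/-- Fourier transform `ĥ(t) = ∫ e^{-i t u} h(u) du`. -/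
noncomputable def FT (h : ℝ → ℝ) (t : ℝ) : ℂ :=
  ∫ u : ℝ, Complex.exp (-(Complex.I * (t : ℂ) * (u : ℂ))) * (h u : ℂ)

/-- Convolution `(g ∗ k)(u) = ∫ g(v) k(u - v) dv`. -/
noncomputable def convR (g k : ℝ → ℝ) (u : ℝ) : ℝ := ∫ v : ℝ, g v * k (u - v)

/-- Stone's kernel `κ`. -/
noncomputable def kapp (u : ℝ) : ℝ :=
  if u = 0 then 1 / (2 * π) else (Real.sin (u / 2) / (u / 2)) ^ 2 / (2 * π)

/-- Scaled kernel `κ_δ(u) = κ(u/δ)/δ`. -/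
noncomputable def kappD (δ u : ℝ) : ℝ := kapp (u / δ) / δ

/-- Upper regularisation `h̄_ε(u) = sup_{v ∈ [u-ε, u+ε]} h(v)`. -/
noncomputable def upReg (h : ℝ → ℝ) (ε u : ℝ) : ℝ := sSup (h '' Set.Icc (u - ε) (u + ε))

/-- Lower regularisation `ẖ_ε(u) = inf_{v ∈ [u-ε, u+ε]} h(v)`. -/
noncomputable def loReg (h : ℝ → ℝ) (ε u : ℝ) : ℝ := sInf (h '' Set.Icc (u - ε) (u + ε))

/-- The class `𝓗_ε`: non-negative, locally bounded, with `h`, `h̄_ε`, `ẖ_ε`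
measurable and Lebesgue integrable. -/
def MemH (ε : ℝ) (h : ℝ → ℝ) : Prop :=
  (∀ u, 0 ≤ h u) ∧ (∀ K : Set ℝ, IsCompact K → BddAbove (h '' K)) ∧
  Measurable h ∧ Measurable (upReg h ε) ∧ Measurable (loReg h ε) ∧
  Integrable h ∧ Integrable (upReg h ε) ∧ Integrable (loReg h ε)


/-- Poisson equation. -/
theorem poisson {X : Type*} [Fintype X] [DecidableEq X] [Nonempty X] (P : X → X → ℝ) (ν : X → ℝ)
  (hconst : ∀ h : X → ℝ, (∀ x, ∑ x', P x x' * h x' = h x) → ∀ x x', h x = h x')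
  (nuSum : ∑ x, ν x = 1) (nuInv : ∀ x', ∑ x, ν x * P x x' = ν x')
  (g : X → ℝ) (hg : ∑ x, ν x * g x = 0) : ∃ u : X → ℝ, ∀ x, u x - ∑ x', P x x' * u x' = g x := by
  classical
  have inv : ∀ h : X → ℝ, ∑ x, ν x * ∑ x', P x x' * h x' = ∑ x, ν x * h x := by
    intro h
    simp_rw [Finset.mul_sum]
    rw [Finset.sum_comm]
    refine Finset.sum_congr rfl fun x' _ => ?_
    rw [← nuInv x', Finset.sum_mul]
    exact Finset.sum_congr rfl fun x _ => by ring
  let T : (X → ℝ) →ₗ[ℝ] (X → ℝ) :=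
    { toFun := fun h x => h x - ∑ x', P x x' * h x' + ∑ x', ν x' * h x'
      map_add' := by
        intro a b; funext x
        simp only [Pi.add_apply, mul_add, Finset.sum_add_distrib]; ring
      map_smul' := by
        intro c a; funext x
        simp only [Pi.smul_apply, smul_eq_mul, RingHom.id_apply, mul_add, mul_sub, Finset.mul_sum]
        congr 1
        · congr 1
          exact Finset.sum_congr rfl fun x _ => by ring
        · exact Finset.sum_congr rfl fun x _ => by ring }
  have key : ∀ h g' : X → ℝ, T h = g' → ∑ x, ν x * h x = ∑ x, ν x * g' x := by
    intro h g' e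
    rw [← e]
    change _ = ∑ x, ν x * (h x - ∑ x', P x x' * h x' + ∑ x', ν x' * h x')
    simp only [mul_add, mul_sub, Finset.sum_add_distrib, Finset.sum_sub_distrib, inv h]
    rw [← Finset.sum_mul, nuSum]; ring
  have hinj : Function.Injective T := by
    rw [injective_iff_map_eq_zero]
    intro h hh
    have h0 := key h 0 hh
    simp only [Pi.zero_apply, mul_zero, Finset.sum_const_zero] at h0
    have hP : ∀ x, ∑ x', P x x' * h x' = h x := by
      intro x
      have := congrFun hh x
      change h x - ∑ x', P x x' * h x' + ∑ x', ν x' * h x' = 0 at this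
      linarith
    have hc := hconst h hP
    funext x
    have : ∑ x', ν x' * h x' = h x := by
      rw [← one_mul (h x), ← nuSum, Finset.sum_mul]
      exact Finset.sum_congr rfl fun x' _ => by rw [hc x' x]
    simp; linarith
  obtain ⟨u, hu⟩ := (LinearMap.injective_iff_surjective.mp hinj) g
  refine ⟨u, fun x => ?_⟩
  have h0 := key u g hu
  have := congrFun hu x
  change u x - ∑ x', P x x' * u x' + ∑ x', ν x' * u x' = g x at this
  linarith

/-- The comparison kernel. -/
noncomputable def Fk (δ t : ℝ) : ℝ := t ^ ((1/2 : ℝ) - 1) * Real.exp (-(δ * t))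

theorem Fk_nonneg (δ : ℝ) {t : ℝ} (ht : 0 ≤ t) : 0 ≤ Fk δ t := by unfold Fk; positivity

theorem Fk_int {δ : ℝ} (hδ : 0 < δ) : IntegrableOn (Fk δ) (Set.Ioi 0) := by
  by_contra h
  have h1 := Real.integral_rpow_mul_exp_neg_mul_Ioi (a := 1/2) (r := δ) (by norm_num) hδ
  have h2 : ∫ t in Set.Ioi 0, Fk δ t = 0 := integral_undef h
  unfold Fk at h2
  rw [h2] at h1
  have : 0 < (1 / δ) ^ (1/2 : ℝ) * Real.Gamma (1/2) := by
    have := Real.Gamma_pos_of_pos (show (0:ℝ) < 1/2 by norm_num)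
    positivity
  linarith

theorem Fk_anti {δ : ℝ} (hδ : 0 < δ) (b : ℝ) : AntitoneOn (Fk δ) (Set.Icc 1 b) := by
  intro s hs t ht hst
  unfold Fk
  have hs0 : 0 < s := by linarith [hs.1]
  gcongr ?_ * ?_
  · exact Real.rpow_le_rpow_of_nonpos hs0 hst (by norm_num)
  · apply Real.exp_le_exp.mpr; nlinarith

theorem Fk_le {δ : ℝ} (n : ℕ) : Fk δ n ≤ Real.exp (-(δ * n)) := by
  unfold Fk
  rcases Nat.eq_zero_or_pos n with h | h
  · subst h; norm_num
  · have : ((n:ℝ)) ^ ((1/2 : ℝ) - 1) ≤ 1 := 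
      Real.rpow_le_one_of_one_le_of_nonpos (by exact_mod_cast h) (by norm_num)
    nlinarith [Real.exp_pos (-(δ * n))]

theorem summable_exp {δ : ℝ} (hδ : 0 < δ) : Summable fun n : ℕ => Real.exp (-(δ * n)) := by
  have : ∀ n : ℕ, Real.exp (-(δ * n)) = Real.exp (-δ) ^ n := by
    intro n; rw [← Real.exp_nat_mul]; congr 1; ring
  simp_rw [this]
  exact summable_geometric_of_lt_one (Real.exp_pos _).le (by rw [Real.exp_lt_one_iff]; linarith)

theorem Fk_summable {δ : ℝ} (hδ : 0 < δ) : Summable fun n : ℕ => Fk δ n :=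
  Summable.of_nonneg_of_le (fun n => Fk_nonneg δ (by positivity)) (fun n => Fk_le n) (summable_exp hδ)

theorem Fk_sum_bound {δ : ℝ} (hδ : 0 < δ) :
    |(∑' n : ℕ, Fk δ n) - (1 / δ) ^ (1/2 : ℝ) * Real.Gamma (1/2)| ≤ 2 := by
  have hI : ∫ t in Set.Ioi 0, Fk δ t = (1 / δ) ^ (1/2 : ℝ) * Real.Gamma (1/2) :=
    Real.integral_rpow_mul_exp_neg_mul_Ioi (a := 1/2) (r := δ) (by norm_num) hδ
  rw [← hI]
  have hFint := Fk_int hδ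
  have h0 : Fk δ 0 = 0 := by unfold Fk; norm_num
  have hsum : ∑' n : ℕ, Fk δ n = ∑' n : ℕ, Fk δ (1 + (n:ℝ)) := by
    rw [(Fk_summable hδ).tsum_eq_zero_add]
    simp [h0, add_comm]
  have hS : Summable fun n : ℕ => Fk δ (1 + (n:ℝ)) := by
    have := (summable_nat_add_iff 1).mpr (Fk_summable hδ)
    simpa [add_comm] using this
  have hT := hS.hasSum.tendsto_sum_nat
  rw [hsum]
  have hFint1 : IntegrableOn (Fk δ) (Set.Ioi 1) := hFint.mono_set (Set.Ioi_subset_Ioi zero_le_one)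
  have hsplit : ∫ t in Set.Ioi 0, Fk δ t = (∫ t in Set.Ioc 0 1, Fk δ t) + ∫ t in Set.Ioi 1, Fk δ t := by
    rw [← setIntegral_union (Set.Ioc_disjoint_Ioi le_rfl) measurableSet_Ioi
      (hFint.mono_set Set.Ioc_subset_Ioi_self) hFint1, Set.Ioc_union_Ioi_eq_Ioi zero_le_one]
  have hle2 : ∫ t in Set.Ioc 0 1, Fk δ t ≤ 2 := by
    have h3 : ∫ t in (0:ℝ)..1, t ^ ((1/2 : ℝ) - 1) = 2 := by
      rw [integral_rpow (Or.inl (by norm_num))]; norm_num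
    rw [← h3, intervalIntegral.integral_of_le zero_le_one]
    apply setIntegral_mono_on (hFint.mono_set Set.Ioc_subset_Ioi_self) ?_ measurableSet_Ioc
    · intro t ht
      unfold Fk
      have := Real.rpow_nonneg ht.1.le ((1/2 : ℝ) - 1)
      have : Real.exp (-(δ * t)) ≤ 1 := by
        rw [Real.exp_le_one_iff]; nlinarith [ht.1]
      nlinarith
    · have := intervalIntegral.intervalIntegrable_rpow' (a := 0) (b := 1) (r := (1/2:ℝ) - 1) (by norm_num)
      rwa [intervalIntegrable_iff_integrableOn_Ioc_of_le zero_le_one] at this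
  have hge0 : 0 ≤ ∫ t in Set.Ioc 0 1, Fk δ t :=
    setIntegral_nonneg measurableSet_Ioc fun t ht => Fk_nonneg δ ht.1.le
  have hint_le : ∀ N : ℕ, ∫ x in (1:ℝ)..1 + N, Fk δ x ≤ ∫ t in Set.Ioi 1, Fk δ t := by
    intro N
    rw [intervalIntegral.integral_of_le (by simp)]
    apply setIntegral_mono_set hFint1
    · filter_upwards [ae_restrict_mem measurableSet_Ioi] with t ht
      exact Fk_nonneg δ (by have := Set.mem_Ioi.mp ht; linarith)
    · exact Set.Ioc_subset_Ioi_self.eventuallyLE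
  have hup : ∑' n : ℕ, Fk δ (1 + (n:ℝ)) ≤ 1 + ∫ t in Set.Ioi 1, Fk δ t := by
    rw [hS.tsum_eq_zero_add]
    have hF1 : Fk δ (1 + ((0:ℕ):ℝ)) ≤ 1 := by
      have := Fk_le (δ := δ) 1
      have h2 : Real.exp (-(δ * (1:ℕ))) ≤ 1 := by rw [Real.exp_le_one_iff]; simp; linarith
      simpa using this.trans h2
    have : ∑' n : ℕ, Fk δ (1 + ((n+1 : ℕ):ℝ)) ≤ ∫ t in Set.Ioi 1, Fk δ t := by
      have hS' : Summable fun n : ℕ => Fk δ (1 + ((n+1 : ℕ):ℝ)) := (summable_nat_add_iff 1).mpr hS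
      refine le_of_tendsto' hS'.hasSum.tendsto_sum_nat fun N => ?_
      exact ((Fk_anti hδ (1 + N)).sum_le_integral).trans (hint_le N)
    linarith
  have hlo : ∫ t in Set.Ioi 1, Fk δ t ≤ ∑' n : ℕ, Fk δ (1 + (n:ℝ)) := by
    have hlim : Tendsto (fun N : ℕ => ∫ x in (1:ℝ)..1 + N, Fk δ x) atTop (𝓝 (∫ t in Set.Ioi 1, Fk δ t)) :=
      intervalIntegral_tendsto_integral_Ioi 1 hFint1
        (tendsto_atTop_add_const_left _ _ tendsto_natCast_atTop_atTop)
    exact le_of_tendsto_of_tendsto' hlim hT fun N => (Fk_anti hδ (1 + N)).integral_le_sum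
  rw [abs_le]
  constructor <;> linarith

theorem Fk_limit : Tendsto (fun δ : ℝ => √δ * ∑' n : ℕ, Fk δ n) (𝓝[>] 0) (𝓝 (Real.Gamma (1/2))) := by
  have h1 : Tendsto (fun δ : ℝ => √δ * 2) (𝓝[>] 0) (𝓝 0) := by
    have : Tendsto (fun δ : ℝ => √δ * 2) (𝓝 0) (𝓝 (√0 * 2)) := by
      apply Continuous.tendsto; fun_prop
    simp only [Real.sqrt_zero, zero_mul] at this
    exact this.mono_left nhdsWithin_le_nhds
  rw [tendsto_iff_norm_sub_tendsto_zero]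
  refine squeeze_zero' (Eventually.of_forall fun _ => norm_nonneg _) ?_ h1
  filter_upwards [self_mem_nhdsWithin] with δ hδ
  have hδ : 0 < δ := hδ
  have hs : 0 < √δ := Real.sqrt_pos.mpr hδ
  have := Fk_sum_bound hδ
  have e : (1 / δ) ^ (1/2 : ℝ) = 1 / √δ := by
    rw [← Real.sqrt_eq_rpow, Real.sqrt_div zero_le_one]; simp
  rw [e] at this
  have e2 : √δ * ∑' n : ℕ, Fk δ n - Real.Gamma (1/2) = √δ * ((∑' n : ℕ, Fk δ n) - 1 / √δ * Real.Gamma (1/2)) := by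
    field_simp
  rw [e2, norm_mul, Real.norm_eq_abs, Real.norm_eq_abs, abs_of_pos hs]
  gcongr

theorem summable_w {d : ℕ → ℝ} {D : ℝ} (hD : ∀ n, |d n| ≤ D) {g : ℝ → ℝ} {G : ℝ}
    (hg : ∀ x ∈ Set.Icc (0:ℝ) 1, |g x| ≤ G) {δ : ℝ} (hδ : 0 < δ) :
    Summable fun n : ℕ => d n * (Real.exp (-(δ * n)) * g (Real.exp (-(δ * n)))) := by
  have hD0 : 0 ≤ D := (abs_nonneg _).trans (hD 0)
  refine Summable.of_norm_bounded ((summable_exp hδ).mul_left (D * G)) fun n => ?_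
  have hmem : Real.exp (-(δ * n)) ∈ Set.Icc (0:ℝ) 1 :=
    ⟨(Real.exp_pos _).le, by rw [Real.exp_le_one_iff, neg_nonpos]; positivity⟩
  have := hg _ hmem
  rw [norm_mul, norm_mul, Real.norm_eq_abs, Real.norm_eq_abs, Real.norm_eq_abs, abs_of_pos (Real.exp_pos _)]
  calc |d n| * (Real.exp (-(δ * n)) * |g (Real.exp (-(δ * n)))|) ≤ D * (Real.exp (-(δ * n)) * G) := by
        gcongr
        exact hD n
    _ = _ := by ring

theorem poly_lim {d : ℕ → ℝ} {D : ℝ} (hD : ∀ n, |d n| ≤ D)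
    (h : Tendsto (fun δ : ℝ => √δ * ∑' n : ℕ, d n * Real.exp (-(δ * n))) (𝓝[>] 0) (𝓝 0))
    (p : Polynomial ℝ) :
    Tendsto (fun δ : ℝ => √δ * ∑' n : ℕ, d n * (Real.exp (-(δ * n)) * p.eval (Real.exp (-(δ * n)))))
      (𝓝[>] 0) (𝓝 0) := by
  have bdd : ∀ q : Polynomial ℝ, ∃ G, ∀ x ∈ Set.Icc (0:ℝ) 1, |q.eval x| ≤ G := by
    intro q
    obtain ⟨G, hG⟩ := isCompact_Icc.exists_bound_of_continuousOn (s := Set.Icc (0:ℝ) 1) (f := fun x => q.eval x) q.continuous.continuousOn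
    exact ⟨G, hG⟩
  induction p using Polynomial.induction_on' with
  | add p q hp hq =>
    have := hp.add hq
    rw [add_zero] at this
    refine this.congr' ?_
    filter_upwards [self_mem_nhdsWithin] with δ hδ
    obtain ⟨G1, h1⟩ := bdd p
    obtain ⟨G2, h2⟩ := bdd q
    rw [← mul_add, ← (summable_w hD h1 hδ).tsum_add (summable_w hD h2 hδ)]
    congr 1
    refine tsum_congr fun n => ?_
    rw [Polynomial.eval_add]; ring
  | monomial k c =>
    have hk : (0:ℝ) < (k:ℝ) + 1 := by positivity
    have hlim : Tendsto (fun δ : ℝ => ((k:ℝ)+1) * δ) (𝓝[>] 0) (𝓝[>] 0) := by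
      apply tendsto_nhdsWithin_of_tendsto_nhds_of_eventually_within
      · have : Tendsto (fun δ : ℝ => ((k:ℝ)+1) * δ) (𝓝 0) (𝓝 (((k:ℝ)+1) * 0)) := by
          apply Continuous.tendsto; fun_prop
        rw [mul_zero] at this
        exact this.mono_left nhdsWithin_le_nhds
      · filter_upwards [self_mem_nhdsWithin] with δ hδ
        exact mul_pos hk hδ
    have h3 := (h.comp hlim).const_mul (c / √((k:ℝ)+1))
    rw [mul_zero] at h3
    refine h3.congr' ?_
    filter_upwards [self_mem_nhdsWithin] with δ hδ
    have hs : 0 < √((k:ℝ)+1) := Real.sqrt_pos.mpr hk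
    simp only [Function.comp]
    rw [Real.sqrt_mul hk.le]
    have : ∀ n : ℕ, d n * (Real.exp (-(δ * n)) * (Polynomial.monomial k c).eval (Real.exp (-(δ * n))))
        = c * (d n * Real.exp (-(((k:ℝ)+1) * δ * n))) := by
      intro n
      rw [Polynomial.eval_monomial, ← Real.exp_nat_mul]
      have : Real.exp (-(((k:ℝ)+1) * δ * n)) = Real.exp (-(δ * n)) * Real.exp (k * -(δ * n)) := by
        rw [← Real.exp_add]; congr 1; ring
      rw [this]; ring
    simp_rw [this]
    rw [tsum_mul_left]
    field_simp

theorem cont_lim {d : ℕ → ℝ} {D : ℝ} (hD : ∀ n, |d n| ≤ D)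
    (h : Tendsto (fun δ : ℝ => √δ * ∑' n : ℕ, d n * Real.exp (-(δ * n))) (𝓝[>] 0) (𝓝 0))
    {C : ℝ} (hC : ∀ᶠ δ in 𝓝[>] (0:ℝ), √δ * ∑' n : ℕ, |d n| * Real.exp (-(δ * n)) ≤ C)
    {g : ℝ → ℝ} (hg : Continuous g) :
    Tendsto (fun δ : ℝ => √δ * ∑' n : ℕ, d n * (Real.exp (-(δ * n)) * g (Real.exp (-(δ * n)))))
      (𝓝[>] 0) (𝓝 0) := by
  rw [Metric.tendsto_nhds]
  intro ε hε
  have hC' : 0 < |C| + 1 := by positivity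
  obtain ⟨p, hp⟩ := exists_polynomial_near_of_continuousOn 0 1 g hg.continuousOn (ε / 2 / (|C| + 1)) (by positivity)
  have hpl := poly_lim hD h p
  rw [Metric.tendsto_nhds] at hpl
  obtain ⟨G1, h1⟩ := isCompact_Icc.exists_bound_of_continuousOn (s := Set.Icc (0:ℝ) 1) (f := fun x => p.eval x) p.continuous.continuousOn
  obtain ⟨G2, h2⟩ := isCompact_Icc.exists_bound_of_continuousOn (s := Set.Icc (0:ℝ) 1) (f := g) hg.continuousOn
  filter_upwards [hpl (ε/2) (by positivity), hC, self_mem_nhdsWithin] with δ hd1 hd2 hδ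
  have hδ : 0 < δ := hδ
  rw [Real.dist_eq, sub_zero] at hd1 ⊢
  have s1 := summable_w hD h1 hδ
  have s2 := summable_w hD h2 hδ
  have sabs : Summable fun n : ℕ => |d n| * Real.exp (-(δ * n)) := by
    have := summable_w (d := fun n => |d n|) (D := D) (by simpa using hD) (g := fun _ => 1) (G := 1) (by simp) hδ
    simpa using this
  have hdiff : |(∑' n : ℕ, d n * (Real.exp (-(δ * n)) * g (Real.exp (-(δ * n))))) - 
      ∑' n : ℕ, d n * (Real.exp (-(δ * n)) * p.eval (Real.exp (-(δ * n))))| ≤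
      (ε / 2 / (|C| + 1)) * ∑' n : ℕ, |d n| * Real.exp (-(δ * n)) := by
    rw [← s2.tsum_sub s1, ← tsum_mul_left, ← Real.norm_eq_abs]
    refine tsum_of_norm_bounded (sabs.mul_left _).hasSum fun n => ?_
    have hmem : Real.exp (-(δ * n)) ∈ Set.Icc (0:ℝ) 1 :=
      ⟨(Real.exp_pos _).le, by rw [Real.exp_le_one_iff, neg_nonpos]; positivity⟩
    have := (hp _ hmem).le
    rw [← mul_sub, ← mul_sub, norm_mul, norm_mul, Real.norm_eq_abs, Real.norm_eq_abs, Real.norm_eq_abs,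
      abs_of_pos (Real.exp_pos _), abs_sub_comm]
    calc |d n| * (Real.exp (-(δ * n)) * |p.eval (Real.exp (-(δ * n))) - g (Real.exp (-(δ * n)))|)
        ≤ |d n| * (Real.exp (-(δ * n)) * (ε / 2 / (|C| + 1))) := by gcongr
      _ = _ := by ring
  have hs : 0 < √δ := Real.sqrt_pos.mpr hδ
  set A := ∑' n : ℕ, d n * (Real.exp (-(δ * n)) * g (Real.exp (-(δ * n))))
  set B := ∑' n : ℕ, d n * (Real.exp (-(δ * n)) * p.eval (Real.exp (-(δ * n))))
  set E := ∑' n : ℕ, |d n| * Real.exp (-(δ * n))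
  have h4 : |√δ * A - √δ * B| ≤ ε / 2 := by
    rw [← mul_sub, abs_mul, abs_of_pos hs]
    calc √δ * |A - B| ≤ √δ * ((ε / 2 / (|C| + 1)) * E) := by gcongr
      _ = (ε / 2 / (|C| + 1)) * (√δ * E) := by ring
      _ ≤ (ε / 2 / (|C| + 1)) * (|C| + 1) := by gcongr; linarith [le_abs_self C]
      _ = ε / 2 := by field_simp
  have := abs_sub_abs_le_abs_sub (√δ * A) (√δ * B)
  linarith

/-- A continuous bump function supported in `[exp (-β), exp (-α)]`. -/
noncomputable def bump (α β x : ℝ) : ℝ :=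
  max 0 ((x - Real.exp (-β)) * (Real.exp (-α) - x))

theorem bump_cont (α β : ℝ) : Continuous (bump α β) := by unfold bump; fun_prop

/-- The weights attached to the bump. -/
noncomputable def bw (α β δ : ℝ) (n : ℕ) : ℝ := Real.exp (-(δ * n)) * bump α β (Real.exp (-(δ * n)))

theorem bw_nonneg (α β δ : ℝ) (n : ℕ) : 0 ≤ bw α β δ n :=
  mul_nonneg (Real.exp_pos _).le (le_max_left _ _)

theorem bw_supp {α β δ : ℝ} (hab : α < β) {n : ℕ} (h : bw α β δ n ≠ 0) : α ≤ δ * n ∧ δ * n ≤ β := by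
  by_contra hc
  apply h
  have hE : Real.exp (-β) < Real.exp (-α) := Real.exp_lt_exp.mpr (by linarith)
  have : bump α β (Real.exp (-(δ * n))) = 0 := by
    unfold bump
    apply max_eq_left
    by_cases h1 : α ≤ δ * n
    · have h2 : β < δ * n := by by_contra h3; exact hc ⟨h1, not_lt.mp h3⟩
      have : Real.exp (-(δ * n)) < Real.exp (-β) := Real.exp_lt_exp.mpr (by linarith)
      nlinarith
    · have : Real.exp (-α) < Real.exp (-(δ * n)) := Real.exp_lt_exp.mpr (by linarith)
      nlinarith
  unfold bw; rw [this, mul_zero]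

theorem bump_bdd (α β : ℝ) : ∃ G, ∀ x ∈ Set.Icc (0:ℝ) 1, |bump α β x| ≤ G :=
  isCompact_Icc.exists_bound_of_continuousOn (bump_cont α β).continuousOn

theorem bw_summable (α β : ℝ) {δ : ℝ} (hδ : 0 < δ) {d : ℕ → ℝ} {D : ℝ} (hD : ∀ n, |d n| ≤ D) :
    Summable fun n => d n * bw α β δ n := by
  obtain ⟨G, hG⟩ := bump_bdd α β
  exact summable_w hD hG hδ

theorem bw_lower {α β : ℝ} (ha : 0 < α) (hab : α < β) :
    ∃ c > 0, ∀ᶠ δ in 𝓝[>] (0:ℝ), c / δ ≤ ∑' n, bw α β δ n := by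
  obtain ⟨α', hα'⟩ : ∃ t, t = α + (β - α) / 3 := ⟨_, rfl⟩
  obtain ⟨β', hβ'⟩ : ∃ t, t = β - (β - α) / 3 := ⟨_, rfl⟩
  have e1 : Real.exp (-β) < Real.exp (-β') := Real.exp_lt_exp.mpr (by linarith)
  have e2 : Real.exp (-α') < Real.exp (-α) := Real.exp_lt_exp.mpr (by linarith)
  obtain ⟨c1, hc1⟩ : ∃ t, t = (Real.exp (-β') - Real.exp (-β)) * (Real.exp (-α) - Real.exp (-α')) := ⟨_, rfl⟩
  have hc1p : 0 < c1 := by rw [hc1]; exact mul_pos (by linarith) (by linarith)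
  obtain ⟨c2, hc2⟩ : ∃ t, t = Real.exp (-β') * c1 := ⟨_, rfl⟩
  have hc2p : 0 < c2 := by rw [hc2]; positivity
  have hlen : 0 < β' - α' := by linarith
  refine ⟨(β' - α') / 2 * c2, by positivity, ?_⟩
  have hev : ∀ᶠ δ in 𝓝[>] (0:ℝ), δ < (β' - α') / 2 :=
    nhdsWithin_le_nhds (eventually_lt_nhds (by positivity))
  filter_upwards [hev, self_mem_nhdsWithin] with δ hδ1 hδ
  have hδ : 0 < δ := hδ
  have hsum : Summable fun n => bw α β δ n := by
    simpa using bw_summable α β hδ (d := fun _ => 1) (D := 1) (by simp)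
  let S := Finset.Icc ⌈α' / δ⌉₊ ⌊β' / δ⌋₊
  have hα'0 : 0 < α' := by linarith
  have hβ'0 : 0 < β' := by linarith
  have hS : ∀ n ∈ S, c2 ≤ bw α β δ n := by
    intro n hn
    rw [Finset.mem_Icc] at hn
    have h1 : α' ≤ δ * n := by
      have := Nat.ceil_le.mp hn.1
      rw [div_le_iff₀ hδ] at this; linarith
    have h2 : δ * n ≤ β' := by
      have := (Nat.le_floor_iff (by positivity)).mp hn.2
      rw [le_div_iff₀ hδ] at this; linarith
    have h3 : Real.exp (-(δ * n)) ≤ Real.exp (-α') := Real.exp_le_exp.mpr (by linarith)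
    have h4 : Real.exp (-β') ≤ Real.exp (-(δ * n)) := Real.exp_le_exp.mpr (by linarith)
    rw [hc2]
    unfold bw
    apply mul_le_mul h4 _ hc1p.le (Real.exp_pos _).le
    unfold bump
    refine le_trans ?_ (le_max_right _ _)
    rw [hc1]
    apply mul_le_mul <;> linarith
  have hcard : (β' - α') / δ - 1 ≤ (S.card : ℝ) := by
    rw [Nat.card_Icc]
    have h1 := Nat.lt_floor_add_one (β' / δ)
    have h2 := Nat.ceil_lt_add_one (show 0 ≤ α' / δ by positivity)
    have h3 : ((⌊β' / δ⌋₊ + 1 : ℕ) : ℝ) - (⌈α' / δ⌉₊ : ℝ) ≤ ((⌊β' / δ⌋₊ + 1 - ⌈α' / δ⌉₊ : ℕ) : ℝ) := by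
      rw [sub_le_iff_le_add]
      exact_mod_cast (by omega)
    push_cast at h3
    rw [sub_div]
    linarith
  have h5 : (β' - α') / 2 / δ ≤ (β' - α') / δ - 1 := by
    rw [div_le_iff₀ hδ, sub_mul, div_mul_cancel₀ _ hδ.ne']; linarith
  calc (β' - α') / 2 * c2 / δ = ((β' - α') / 2 / δ) * c2 := by ring
    _ ≤ S.card * c2 := by gcongr; linarith
    _ = ∑ n ∈ S, c2 := by simp
    _ ≤ ∑ n ∈ S, bw α β δ n := Finset.sum_le_sum hS
    _ ≤ _ := hsum.sum_le_tsum _ fun n _ => bw_nonneg _ _ _ _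

theorem inv_nat_tendsto : Tendsto (fun N : ℕ => (1:ℝ) / N) atTop (𝓝[>] 0) := by
  apply tendsto_nhdsWithin_of_tendsto_nhds_of_eventually_within
  · exact tendsto_one_div_atTop_nhds_zero_nat
  · filter_upwards [eventually_gt_atTop 0] with N hN
    simp; omega

theorem tauber {a : ℕ → ℝ} (ha : Antitone a) (h0 : ∀ n, 0 ≤ a n) {L : ℝ}
    (h : Tendsto (fun δ : ℝ => √δ * ∑' n : ℕ, a n * Real.exp (-(δ * n))) (𝓝[>] 0) (𝓝 L)) :
    ∃ l, 0 ≤ l ∧ Tendsto (fun n : ℕ => √n * a n) atTop (𝓝 l) := by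
  have hL : 0 ≤ L := by
    refine ge_of_tendsto' h fun δ => mul_nonneg (Real.sqrt_nonneg _) (tsum_nonneg fun n => ?_)
    exact mul_nonneg (h0 n) (Real.exp_pos _).le
  have hG := Real.Gamma_pos_of_pos (show (0:ℝ) < 1/2 by norm_num)
  obtain ⟨κ, hκ⟩ : ∃ t, t = L / Real.Gamma (1/2) := ⟨_, rfl⟩
  have hκ0 : 0 ≤ κ := by rw [hκ]; positivity
  let b : ℕ → ℝ := fun n => (n:ℝ) ^ ((1/2 : ℝ) - 1)
  have hb0 : ∀ n, 0 ≤ b n := fun n => by positivity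
  have hb1 : ∀ n, |b n| ≤ 1 := by
    intro n
    rw [abs_of_nonneg (hb0 n)]
    have := Fk_le (δ := 0) n
    simpa [Fk, b] using this
  have haD : ∀ n, |a n| ≤ a 0 := fun n => by rw [abs_of_nonneg (h0 n)]; exact ha (Nat.zero_le n)
  let d : ℕ → ℝ := fun n => a n - κ * b n
  have hdabs : ∀ n, |d n| ≤ a n + κ * b n := by
    intro n
    rw [abs_le]; constructor <;> simp only [d] <;> nlinarith [h0 n, mul_nonneg hκ0 (hb0 n)]
  have hd : ∀ n, |d n| ≤ a 0 + κ := by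
    intro n
    have := hb1 n
    rw [abs_of_nonneg (hb0 n)] at this
    nlinarith [hdabs n, ha (Nat.zero_le n)]
  have sa : ∀ {δ : ℝ}, 0 < δ → Summable fun n : ℕ => a n * Real.exp (-(δ * n)) := by
    intro δ hδ
    simpa using summable_w haD (g := fun _ => 1) (G := 1) (by simp) hδ
  have sb : ∀ {δ : ℝ}, 0 < δ → Summable fun n : ℕ => b n * Real.exp (-(δ * n)) := by
    intro δ hδ
    exact Fk_summable hδ
  have sd : ∀ {δ : ℝ}, 0 < δ → Summable fun n : ℕ => |d n| * Real.exp (-(δ * n)) := by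
    intro δ hδ
    simpa using summable_w (d := fun n => |d n|) (D := a 0 + κ) (by simpa using hd) (g := fun _ => 1) (G := 1) (by simp) hδ
  have hblim : Tendsto (fun δ : ℝ => √δ * ∑' n : ℕ, b n * Real.exp (-(δ * n))) (𝓝[>] 0) (𝓝 (Real.Gamma (1/2))) :=
    Fk_limit
  have hdlim : Tendsto (fun δ : ℝ => √δ * ∑' n : ℕ, d n * Real.exp (-(δ * n))) (𝓝[>] 0) (𝓝 0) := by
    have := h.sub (hblim.const_mul κ)
    rw [show L - κ * Real.Gamma (1/2) = 0 by rw [hκ]; field_simp; ring] at this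
    refine this.congr' ?_
    filter_upwards [self_mem_nhdsWithin] with δ hδ
    have e : ∀ n : ℕ, d n * Real.exp (-(δ * n)) = a n * Real.exp (-(δ * n)) - κ * (b n * Real.exp (-(δ * n))) := by
      intro n; simp only [d]; ring
    simp_rw [e]
    rw [(sa hδ).tsum_sub ((sb hδ).mul_left κ), tsum_mul_left]; ring
  have hC : ∀ᶠ δ in 𝓝[>] (0:ℝ), √δ * ∑' n : ℕ, |d n| * Real.exp (-(δ * n)) ≤ L + κ * Real.Gamma (1/2) + 1 := by
    have := h.add (hblim.const_mul κ)
    filter_upwards [self_mem_nhdsWithin, this.eventually (eventually_lt_nhds (lt_add_one _))] with δ hδ hlt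
    refine le_trans ?_ hlt.le
    have : ∑' n : ℕ, |d n| * Real.exp (-(δ * n)) ≤ ∑' n : ℕ, (a n * Real.exp (-(δ * n)) + κ * (b n * Real.exp (-(δ * n)))) := by
      refine (sd hδ).tsum_le_tsum (fun n => ?_) ((sa hδ).add ((sb hδ).mul_left κ))
      have := mul_le_mul_of_nonneg_right (hdabs n) (Real.exp_pos (-(δ * n))).le
      linarith
    rw [(sa hδ).tsum_add ((sb hδ).mul_left κ), tsum_mul_left] at this
    calc _ ≤ _ := mul_le_mul_of_nonneg_left this (Real.sqrt_nonneg δ)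
      _ = _ := by ring
  -- core estimate
  have core : ∀ α β : ℝ, 0 < α → α < β → ∀ η > 0, ∀ᶠ N : ℕ in atTop, 0 < N ∧
      0 < ∑' n, bw α β (1/N) n ∧
      |(∑' n, a n * bw α β (1/N) n) - κ * ∑' n, b n * bw α β (1/N) n| ≤ 
        η / √N * ∑' n, bw α β (1/N) n := by
    intro α β h1 h2 η hη
    obtain ⟨c, hc, hcl⟩ := bw_lower h1 h2
    have hlim := cont_lim hd hdlim hC (bump_cont α β)
    rw [Metric.tendsto_nhds] at hlim
    filter_upwards [eventually_gt_atTop 0, inv_nat_tendsto.eventually hcl,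
      inv_nat_tendsto.eventually (hlim (η * c) (by positivity))] with N hN hN1 hN2
    have hNr : (0:ℝ) < N := by exact_mod_cast hN
    have hδ : (0:ℝ) < 1 / N := by positivity
    rw [Real.dist_eq, sub_zero, abs_mul, abs_of_nonneg (Real.sqrt_nonneg _)] at hN2
    have hm : 0 < ∑' n, bw α β (1/N) n := lt_of_lt_of_le (by positivity) hN1
    refine ⟨hN, hm, ?_⟩
    have hT : ∑' n : ℕ, d n * (Real.exp (-(1 / (N:ℝ) * n)) * bump α β (Real.exp (-(1 / (N:ℝ) * n))))
       = (∑' n, a n * bw α β (1/N) n) - κ * ∑' n, b n * bw α β (1/N) n := by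
      rw [← tsum_mul_left, ← (bw_summable α β hδ haD).tsum_sub ((bw_summable α β hδ hb1).mul_left κ)]
      refine tsum_congr fun n => ?_
      simp only [d, bw]; ring
    rw [hT] at hN2
    have hs : 0 < √(N:ℝ) := Real.sqrt_pos.mpr hNr
    rw [Real.sqrt_div zero_le_one, Real.sqrt_one, one_div, inv_mul_lt_iff₀ hs] at hN2
    refine hN2.le.trans ?_
    have : η / √N * (c / (1 / N)) ≤ η / √N * ∑' n, bw α β (1/N) n := by gcongr
    refine le_trans (le_of_eq ?_) this
    have hsq : √(N:ℝ) * √(N:ℝ) = N := Real.mul_self_sqrt hNr.le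
    field_simp
    rw [pow_two, hsq]
  have hbval : ∀ t : ℝ, 0 < t → t ^ ((1/2 : ℝ) - 1) = 1 / √t := by
    intro t ht
    rw [show (1/2 : ℝ) - 1 = -(1/2) by norm_num, Real.rpow_neg ht.le, ← Real.sqrt_eq_rpow, one_div]
  have lower : ∀ β > 1, ∀ η > 0, ∀ᶠ N : ℕ in atTop, κ / √β - η ≤ √N * a N := by
    intro β hβ η hη
    filter_upwards [core 1 β one_pos hβ η hη] with N ⟨hN, hm, hN2⟩
    have hNr : (0:ℝ) < N := by exact_mod_cast hN
    have hδ : (0:ℝ) < 1 / N := by positivity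
    have hs : 0 < √(N:ℝ) := Real.sqrt_pos.mpr hNr
    have hsw : Summable fun n => bw 1 β (1/N) n := by
      simpa using bw_summable 1 β hδ (d := fun _ => 1) (D := 1) (by simp)
    have i1 : ∑' n, a n * bw 1 β (1/N) n ≤ a N * ∑' n, bw 1 β (1/N) n := by
      rw [← tsum_mul_left]
      refine (bw_summable 1 β hδ haD).tsum_le_tsum (fun n => ?_) (hsw.mul_left _)
      by_cases hz : bw 1 β (1/N) n = 0
      · rw [hz]; simp
      · have := (bw_supp hβ hz).1
        have hn : N ≤ n := by
          rw [one_div, inv_mul_eq_div, le_div_iff₀ hNr, one_mul] at this; exact_mod_cast this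
        exact mul_le_mul_of_nonneg_right (ha hn) (bw_nonneg _ _ _ _)
    have i2 : 1 / √(β * N) * ∑' n, bw 1 β (1/N) n ≤ ∑' n, b n * bw 1 β (1/N) n := by
      rw [← tsum_mul_left]
      refine (hsw.mul_left _).tsum_le_tsum (fun n => ?_) (bw_summable 1 β hδ hb1)
      by_cases hz : bw 1 β (1/N) n = 0
      · rw [hz]; simp
      · have := bw_supp hβ hz
        have hn1 : (N:ℝ) ≤ n := by
          have := this.1
          rw [one_div, inv_mul_eq_div, le_div_iff₀ hNr, one_mul] at this; exact this
        have hn2 : (n:ℝ) ≤ β * N := by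
          have := this.2
          rw [one_div, inv_mul_eq_div, div_le_iff₀ hNr] at this; exact this
        refine mul_le_mul_of_nonneg_right ?_ (bw_nonneg _ _ _ _)
        simp only [b]
        have hn0 : (0:ℝ) < n := by linarith
        rw [hbval n hn0]
        exact one_div_le_one_div_of_le (Real.sqrt_pos.mpr hn0) (Real.sqrt_le_sqrt hn2)
    set m := ∑' n, bw 1 β (1/N) n
    have h3 := (abs_le.mp hN2).1
    have h4 : (κ * (1 / √(β * N)) - η / √N) * m ≤ a N * m := by
      have := mul_le_mul_of_nonneg_left i2 hκ0
      nlinarith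
    have h5 := le_of_mul_le_mul_right h4 hm
    have h6 := mul_le_mul_of_nonneg_left h5 hs.le
    refine le_trans (le_of_eq ?_) h6
    rw [Real.sqrt_mul (by linarith)]
    have : 0 < √β := Real.sqrt_pos.mpr (by linarith)
    field_simp
  have upper : ∀ α < 1, 0 < α → ∀ η > 0, ∀ᶠ N : ℕ in atTop, √N * a N ≤ κ / √α + η := by
    intro α hα1 hα η hη
    filter_upwards [core α 1 hα hα1 η hη] with N ⟨hN, hm, hN2⟩
    have hNr : (0:ℝ) < N := by exact_mod_cast hN
    have hδ : (0:ℝ) < 1 / N := by positivity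
    have hs : 0 < √(N:ℝ) := Real.sqrt_pos.mpr hNr
    have hsw : Summable fun n => bw α 1 (1/N) n := by
      simpa using bw_summable α 1 hδ (d := fun _ => 1) (D := 1) (by simp)
    have i1 : a N * ∑' n, bw α 1 (1/N) n ≤ ∑' n, a n * bw α 1 (1/N) n := by
      rw [← tsum_mul_left]
      refine (hsw.mul_left _).tsum_le_tsum (fun n => ?_) (bw_summable α 1 hδ haD)
      by_cases hz : bw α 1 (1/N) n = 0
      · rw [hz]; simp
      · have := (bw_supp hα1 hz).2
        have hn : n ≤ N := by
          rw [one_div, inv_mul_eq_div, div_le_iff₀ hNr, one_mul] at this; exact_mod_cast this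
        exact mul_le_mul_of_nonneg_right (ha hn) (bw_nonneg _ _ _ _)
    have i2 : ∑' n, b n * bw α 1 (1/N) n ≤ 1 / √(α * N) * ∑' n, bw α 1 (1/N) n := by
      rw [← tsum_mul_left]
      refine (bw_summable α 1 hδ hb1).tsum_le_tsum (fun n => ?_) (hsw.mul_left _)
      by_cases hz : bw α 1 (1/N) n = 0
      · rw [hz]; simp
      · have := bw_supp hα1 hz
        have hn1 : α * N ≤ n := by
          have := this.1
          rw [one_div, inv_mul_eq_div, le_div_iff₀ hNr] at this; exact this
        refine mul_le_mul_of_nonneg_right ?_ (bw_nonneg _ _ _ _)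
        simp only [b]
        have hn0 : (0:ℝ) < α * N := by positivity
        rw [hbval n (by linarith)]
        exact one_div_le_one_div_of_le (Real.sqrt_pos.mpr hn0) (Real.sqrt_le_sqrt hn1)
    set m := ∑' n, bw α 1 (1/N) n
    have h3 := (abs_le.mp hN2).2
    have h4 : a N * m ≤ (κ * (1 / √(α * N)) + η / √N) * m := by
      have := mul_le_mul_of_nonneg_left i2 hκ0
      nlinarith
    have h5 := le_of_mul_le_mul_right h4 hm
    have h6 := mul_le_mul_of_nonneg_left h5 hs.le
    refine le_trans h6 (le_of_eq ?_)
    rw [Real.sqrt_mul (by linarith)]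
    have : 0 < √α := Real.sqrt_pos.mpr (by linarith)
    field_simp
  refine ⟨κ, hκ0, ?_⟩
  have hcont : Tendsto (fun t : ℝ => κ / √t) (𝓝 1) (𝓝 κ) := by
    have : ContinuousAt (fun t : ℝ => κ / √t) 1 := by
      apply ContinuousAt.div continuousAt_const (by fun_prop) (by simp)
    simpa [ContinuousAt] using this
  rw [Metric.tendsto_nhds]
  intro ε hε
  have hev := hcont.eventually (Metric.ball_mem_nhds κ (half_pos hε))
  have hevr : ∀ᶠ t in 𝓝[>] (1:ℝ), dist (κ / √t) κ < ε / 2 := nhdsWithin_le_nhds hev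
  have hevl : ∀ᶠ t in 𝓝[<] (1:ℝ), dist (κ / √t) κ < ε / 2 := nhdsWithin_le_nhds hev
  have hgt : ∀ᶠ t in 𝓝[>] (1:ℝ), 1 < t := self_mem_nhdsWithin
  have hlt : ∀ᶠ t in 𝓝[<] (1:ℝ), t < 1 := self_mem_nhdsWithin
  obtain ⟨β, hβ, hβ1⟩ := (hevr.and hgt).exists
  have hev0 : ∀ᶠ t in 𝓝[<] (1:ℝ), 0 < t := nhdsWithin_le_nhds (eventually_gt_nhds one_pos)
  obtain ⟨α, ⟨hα, hα1⟩, hα0⟩ := ((hevl.and hlt).and hev0).exists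
  filter_upwards [lower β hβ1 (ε/2) (half_pos hε), upper α hα1 hα0 (ε/2) (half_pos hε)] with N hl hu
  rw [Real.dist_eq, abs_lt] at *
  constructor <;> linarith
theorem Spath_cons (f : X → ℝ) {n : ℕ} (x a : X) (p : Fin n → X) (k : ℕ) (hk : k ≤ n) :
    Spath f (pathExt x (Fin.cons a p : Fin (n + 1) → X)) (k + 1) = f a + Spath f (pathExt a p) k := by
  induction k with
  | zero => 
    simp [Spath, pathExt]
  | succ k ih =>
    have e : ∀ (ω : ℕ → X) (m : ℕ), Spath f ω (m + 1) = Spath f ω m + f (ω (m + 1)) := by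
      intro ω m
      unfold Spath
      rw [Finset.sum_Icc_succ_top (by omega)]
    rw [e, ih (by omega), e, add_assoc]
    congr 2
    unfold pathExt
    rw [dif_pos (by omega), dif_pos (by omega)]
    have : (⟨k + 1 + 1 - 1, by omega⟩ : Fin (n + 1)) = Fin.succ ⟨k + 1 - 1, by omega⟩ := by
      ext; simp
    rw [this, Fin.cons_succ]

theorem survives_cons (f : X → ℝ) {n : ℕ} (x a : X) (p : Fin n → X) (y : ℝ) :
    survives f y (n + 1) (pathExt x (Fin.cons a p : Fin (n + 1) → X)) ↔
      (0 < y + f a ∧ survives f (y + f a) n (pathExt a p)) := by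
  unfold survives
  constructor
  · intro h
    constructor
    · have := h 1 (by simp)
      have e := Spath_cons f x a p 0 (by omega)
      rw [zero_add] at e
      rw [e] at this
      simpa [Spath] using this
    · intro k hk
      rw [Finset.mem_Icc] at hk
      have := h (k + 1) (by rw [Finset.mem_Icc]; omega)
      rw [Spath_cons f x a p k hk.2] at this
      linarith
  · rintro ⟨h1, h2⟩ k hk
    rw [Finset.mem_Icc] at hk
    obtain ⟨j, rfl⟩ : ∃ j, k = j + 1 := ⟨k - 1, by omega⟩
    rw [Spath_cons f x a p j (by omega)]
    rcases Nat.eq_zero_or_pos j with h | h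
    · subst h; simpa [Spath] using h1
    · have := h2 j (by rw [Finset.mem_Icc]; omega)
      linarith

section Markov

variable [Fintype X] (P : X → X → ℝ) (f : X → ℝ)

theorem ind_true {p : Prop} (h : p) : ind p = 1 := by unfold ind; simp [h]
theorem ind_false {p : Prop} (h : ¬ p) : ind p = 0 := by unfold ind; simp [h]
theorem ind_nonneg (p : Prop) : 0 ≤ ind p := by unfold ind; split_ifs <;> simp
theorem ind_and (p q : Prop) : ind (p ∧ q) = ind p * ind q := by
  by_cases hp : p <;> by_cases hq : q <;> simp [ind, hp, hq]

/-- The kernel killed when entering the nonpositive half-line. -/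
noncomputable def Kop : (X → ℝ → ℝ) →ₗ[ℝ] (X → ℝ → ℝ) where
  toFun φ x y := ∑ x', P x x' * (ind (0 < y + f x') * φ x' (y + f x'))
  map_add' a b := by
    funext x y
    simp only [Pi.add_apply, mul_add, Finset.sum_add_distrib]
  map_smul' c a := by
    funext x y
    simp only [Pi.smul_apply, smul_eq_mul, RingHom.id_apply, Finset.mul_sum]
    exact Finset.sum_congr rfl fun x' _ => by ring

/-- The part of the kernel which enters the nonpositive half-line. -/
noncomputable def Bop : (X → ℝ → ℝ) →ₗ[ℝ] (X → ℝ → ℝ) where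
  toFun φ x y := ∑ x', P x x' * (ind (y + f x' ≤ 0) * φ x' (y + f x'))
  map_add' a b := by
    funext x y
    simp only [Pi.add_apply, mul_add, Finset.sum_add_distrib]
  map_smul' c a := by
    funext x y
    simp only [Pi.smul_apply, smul_eq_mul, RingHom.id_apply, Finset.mul_sum]
    exact Finset.sum_congr rfl fun x' _ => by ring

theorem Kop_apply (φ : X → ℝ → ℝ) (x : X) (y : ℝ) :
    Kop P f φ x y = ∑ x', P x x' * (ind (0 < y + f x') * φ x' (y + f x')) := rfl

theorem Bop_apply (φ : X → ℝ → ℝ) (x : X) (y : ℝ) :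
    Bop P f φ x y = ∑ x', P x x' * (ind (y + f x' ≤ 0) * φ x' (y + f x')) := rfl

theorem KB_apply (φ : X → ℝ → ℝ) (x : X) (y : ℝ) :
    Kop P f φ x y + Bop P f φ x y = ∑ x', P x x' * φ x' (y + f x') := by
  rw [Kop_apply, Bop_apply, ← Finset.sum_add_distrib]
  refine Finset.sum_congr rfl fun x' _ => ?_
  by_cases h : 0 < y + f x'
  · rw [ind_true h, ind_false (not_le.mpr h)]; ring
  · rw [ind_false h, ind_true (not_lt.mp h)]; ring

/-- Survival probabilities. -/
noncomputable def qs (n : ℕ) (x : X) (y : ℝ) : ℝ := ((Kop P f) ^ n) (fun _ _ => 1) x y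

theorem qs_zero (x : X) (y : ℝ) : qs P f 0 x y = 1 := rfl

theorem qs_succ (n : ℕ) (x : X) (y : ℝ) :
    qs P f (n + 1) x y = ∑ x', P x x' * (ind (0 < y + f x') * qs P f n x' (y + f x')) := by
  unfold qs
  rw [pow_succ', Module.End.mul_apply, Kop_apply]

theorem Ex_eq_qs (n : ℕ) : ∀ (x : X) (y : ℝ),
    Ex P x n (fun ω => ind (survives f y n ω)) = qs P f n x y := by
  induction n with
  | zero =>
    intro x y
    simp [Ex, qs_zero, wt, survives, ind]
  | succ n ih =>
    intro x y
    rw [qs_succ]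
    unfold Ex
    rw [← (Fin.consEquiv fun _ : Fin (n + 1) => X).sum_comp, Fintype.sum_prod_type]
    refine Finset.sum_congr rfl fun a _ => ?_
    rw [← ih]
    unfold Ex
    rw [Finset.mul_sum, Finset.mul_sum]
    refine Finset.sum_congr rfl fun p _ => ?_
    change wt P x (List.ofFn (Fin.cons a p : Fin (n + 1) → X)) *
      ind (survives f y (n + 1) (pathExt x (Fin.cons a p : Fin (n + 1) → X))) = _
    rw [survives_cons, ind_and, List.ofFn_succ]
    simp only [Fin.cons_zero, Fin.cons_succ, wt]
    ring

end Markov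

theorem Kpow_mono [Fintype X] {P : X → X → ℝ} {f : X → ℝ} (hP : ∀ x x', 0 ≤ P x x')
    {φ ψ : X → ℝ → ℝ} (h : ∀ x y, 0 < y → φ x y ≤ ψ x y) (n : ℕ) :
    ∀ x y, 0 < y → ((Kop P f) ^ n) φ x y ≤ ((Kop P f) ^ n) ψ x y := by
  induction n with
  | zero => exact h
  | succ n ih =>
    intro x y hy
    rw [pow_succ', Module.End.mul_apply, Module.End.mul_apply, Kop_apply, Kop_apply]
    refine Finset.sum_le_sum fun x' _ => mul_le_mul_of_nonneg_left ?_ (hP x x')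
    by_cases h' : 0 < y + f x'
    · rw [ind_true h', one_mul, one_mul]; exact ih _ _ h'
    · rw [ind_false h']; simp

theorem Kpow_abs [Fintype X] {P : X → X → ℝ} {f : X → ℝ} (hP : ∀ x x', 0 ≤ P x x')
    {φ ψ : X → ℝ → ℝ} (h : ∀ x y, 0 < y → |φ x y| ≤ ψ x y) (n : ℕ)
    (x : X) (y : ℝ) (hy : 0 < y) : |((Kop P f) ^ n) φ x y| ≤ ((Kop P f) ^ n) ψ x y := by
  rw [abs_le]
  constructor
  · have := Kpow_mono (f := f) hP (φ := -ψ) (ψ := φ) (fun x y hy => by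
      have := (abs_le.mp (h x y hy)).1; simpa using this) n x y hy
    rw [map_neg] at this
    exact this
  · exact Kpow_mono hP (fun x y hy => (abs_le.mp (h x y hy)).2) n x y hy

theorem qs_nonneg [Fintype X] {P : X → X → ℝ} {f : X → ℝ} (hP : ∀ x x', 0 ≤ P x x') (n : ℕ) :
    ∀ (x : X) (y : ℝ), 0 ≤ qs P f n x y := by
  induction n with
  | zero => intro x y; rw [qs_zero]; exact zero_le_one
  | succ n ih =>
    intro x y
    rw [qs_succ]
    exact Finset.sum_nonneg fun x' _ => mul_nonneg (hP _ _) (mul_nonneg (ind_nonneg _) (ih _ _))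

theorem ind_le_one (p : Prop) : ind p ≤ 1 := by unfold ind; split_ifs <;> simp

theorem ind_mono {p q : Prop} (h : p → q) : ind p ≤ ind q := by
  by_cases hp : p
  · rw [ind_true hp, ind_true (h hp)]
  · rw [ind_false hp]; exact ind_nonneg _

theorem qs_anti_step [Fintype X] {P : X → X → ℝ} {f : X → ℝ} (hP : ∀ x x', 0 ≤ P x x')
    (hrow : ∀ x, ∑ x', P x x' = 1) (n : ℕ) :
    ∀ (x : X) (y : ℝ), qs P f (n + 1) x y ≤ qs P f n x y := by
  induction n with
  | zero =>
    intro x y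
    rw [qs_succ, qs_zero, ← hrow x]
    refine Finset.sum_le_sum fun x' _ => ?_
    rw [qs_zero, mul_one]
    exact mul_le_of_le_one_right (hP _ _) (ind_le_one _)
  | succ n ih =>
    intro x y
    rw [qs_succ, qs_succ P f n]
    exact Finset.sum_le_sum fun x' _ => mul_le_mul_of_nonneg_left
      (mul_le_mul_of_nonneg_left (ih _ _) (ind_nonneg _)) (hP _ _)

theorem qs_antitone [Fintype X] {P : X → X → ℝ} {f : X → ℝ} (hP : ∀ x x', 0 ≤ P x x')
    (hrow : ∀ x, ∑ x', P x x' = 1) (x : X) (y : ℝ) : Antitone fun n => qs P f n x y :=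
  antitone_nat_of_succ_le fun n => qs_anti_step hP hrow n x y

theorem qs_le_one [Fintype X] {P : X → X → ℝ} {f : X → ℝ} (hP : ∀ x x', 0 ≤ P x x')
    (hrow : ∀ x, ∑ x', P x x' = 1) (n : ℕ) (x : X) (y : ℝ) : qs P f n x y ≤ 1 :=
  (qs_antitone hP hrow x y (Nat.zero_le n)).trans_eq (qs_zero P f x y)

theorem qs_mono_y [Fintype X] {P : X → X → ℝ} {f : X → ℝ} (hP : ∀ x x', 0 ≤ P x x') (n : ℕ) :
    ∀ (x : X) (y y' : ℝ), y ≤ y' → qs P f n x y ≤ qs P f n x y' := by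
  induction n with
  | zero => intro x y y' _; rw [qs_zero, qs_zero]
  | succ n ih =>
    intro x y y' h
    rw [qs_succ, qs_succ]
    refine Finset.sum_le_sum fun x' _ => mul_le_mul_of_nonneg_left ?_ (hP _ _)
    exact mul_le_mul (ind_mono fun h' => by linarith) (ih _ _ _ (by linarith)) (qs_nonneg hP _ _ _) (ind_nonneg _)

/-- Exit probabilities at step `n + 1`. -/
noncomputable def ps [Fintype X] (P : X → X → ℝ) (f : X → ℝ) (n : ℕ) (x : X) (y : ℝ) : ℝ :=
  ((Kop P f) ^ n) (Bop P f (fun _ _ => 1)) x y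

theorem ps_eq [Fintype X] {P : X → X → ℝ} {f : X → ℝ}
    (hrow : ∀ x, ∑ x', P x x' = 1) (n : ℕ) (x : X) (y : ℝ) :
    ps P f n x y = qs P f n x y - qs P f (n + 1) x y := by
  have h1 : Bop P f (fun _ _ => 1) = (fun _ _ => 1) - Kop P f (fun _ _ => 1) := by
    funext x y
    have := KB_apply P f (fun _ _ => 1) x y
    simp only [mul_one, hrow] at this
    simp only [Pi.sub_apply]
    linarith
  unfold ps qs
  rw [h1, map_sub, pow_succ]
  rfl

theorem ps_nonneg [Fintype X] {P : X → X → ℝ} {f : X → ℝ} (hP : ∀ x x', 0 ≤ P x x')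
    (hrow : ∀ x, ∑ x', P x x' = 1) (n : ℕ) (x : X) (y : ℝ) : 0 ≤ ps P f n x y := by
  rw [ps_eq hrow]; linarith [qs_anti_step (f := f) hP hrow n x y]

theorem ps_sum_le [Fintype X] {P : X → X → ℝ} {f : X → ℝ} (hP : ∀ x x', 0 ≤ P x x')
    (hrow : ∀ x, ∑ x', P x x' = 1) (N : ℕ) (x : X) (y : ℝ) : ∑ n ∈ range N, ps P f n x y ≤ 1 := by
  simp_rw [ps_eq hrow]
  rw [Finset.sum_range_sub' (fun n => qs P f n x y)]
  rw [qs_zero]; linarith [qs_nonneg (f := f) hP N x y]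

theorem ps_summable [Fintype X] {P : X → X → ℝ} {f : X → ℝ} (hP : ∀ x x', 0 ≤ P x x')
    (hrow : ∀ x, ∑ x', P x x' = 1) (x : X) (y : ℝ) : Summable fun n => ps P f n x y :=
  summable_of_sum_range_le (fun n => ps_nonneg hP hrow n x y) fun N => ps_sum_le hP hrow N x y

theorem telescope [Fintype X] (P : X → X → ℝ) (f : X → ℝ) (ψ : X → ℝ → ℝ) (s : ℝ) (x : X) (y : ℝ) (N : ℕ) :
    ψ x y = ∑ n ∈ range N, (s ^ n * ((Kop P f) ^ n) (ψ - s • Kop P f ψ - s • Bop P f ψ) x y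
      + s ^ (n + 1) * ((Kop P f) ^ n) (Bop P f ψ) x y) + s ^ N * ((Kop P f) ^ N) ψ x y := by
  induction N with
  | zero => simp
  | succ N ih =>
    rw [Finset.sum_range_succ]
    rw [map_sub, map_sub, map_smul, map_smul, pow_succ (Kop P f) N, Module.End.mul_apply]
    simp only [Pi.sub_apply, Pi.smul_apply, smul_eq_mul]
    rw [ih]
    ring_nf

theorem expansion {f u w M θ : ℝ} (hf : |f| ≤ M) (hu : |u| ≤ M) (hw : |w| ≤ M) (hM : 1 ≤ M)
    (hθ : 0 < θ) (hθM : θ * M ≤ 1) :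
    |Real.exp (-(θ * f)) * (1 - θ * u + θ ^ 2 * w) -
      (1 - θ * (f + u) + θ ^ 2 * (f ^ 2 / 2 + f * u + w))| ≤ 10 * M ^ 3 * θ ^ 3 := by
  have hθ1 : θ ≤ 1 := by nlinarith
  have hz : |-(θ * f)| ≤ θ * M := by rw [abs_neg, abs_mul, abs_of_pos hθ]; gcongr
  have hR : |Real.exp (-(θ * f)) - (1 - θ * f + (θ * f) ^ 2 / 2)| ≤ (θ * M) ^ 3 := by
    have h1 := Real.exp_bound (x := -(θ * f)) (hz.trans hθM) (n := 3) (by norm_num)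
    have e : ∑ m ∈ range 3, (-(θ * f)) ^ m / (m.factorial : ℝ) = 1 - θ * f + (θ * f) ^ 2 / 2 := by
      simp [Finset.sum_range_succ, Nat.factorial]; ring
    rw [e] at h1
    refine h1.trans ?_
    have h2 : |-(θ * f)| ^ 3 ≤ (θ * M) ^ 3 := by gcongr
    have h3 : ((Nat.succ 3 : ℕ) : ℝ) / ((Nat.factorial 3 : ℕ) * (3 : ℕ)) ≤ 1 := by norm_num [Nat.factorial]
    calc _ ≤ (θ * M) ^ 3 * 1 := by gcongr
      _ = _ := mul_one _
  set R := Real.exp (-(θ * f)) - (1 - θ * f + (θ * f) ^ 2 / 2) with hRdef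
  have hE : Real.exp (-(θ * f)) = 1 - θ * f + (θ * f) ^ 2 / 2 + R := by rw [hRdef]; ring
  rw [hE]
  have e : (1 - θ * f + (θ * f) ^ 2 / 2 + R) * (1 - θ * u + θ ^ 2 * w) -
      (1 - θ * (f + u) + θ ^ 2 * (f ^ 2 / 2 + f * u + w)) =
      R * (1 - θ * u + θ ^ 2 * w) - θ ^ 3 * (f * w) - θ ^ 3 * (f * f * u / 2) + θ ^ 3 * (θ * (f * f * w) / 2) := by ring
  rw [e]
  have hρ : |1 - θ * u + θ ^ 2 * w| ≤ 3 := by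
    have h1 : |θ * u| ≤ 1 := by rw [abs_mul, abs_of_pos hθ]; nlinarith
    have h2 : |θ ^ 2 * w| ≤ 1 := by
      rw [abs_mul, abs_of_pos (by positivity)]
      calc θ ^ 2 * |w| ≤ θ ^ 2 * M := by gcongr
        _ = θ * (θ * M) := by ring
        _ ≤ 1 * 1 := by gcongr
        _ = 1 := by norm_num
    rw [abs_le] at *
    constructor <;> linarith [h1.1, h1.2, h2.1, h2.2]
  have t1 : |R * (1 - θ * u + θ ^ 2 * w)| ≤ (θ * M) ^ 3 * 3 := by
    rw [abs_mul]; gcongr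
  have M2 : M ^ 2 ≤ M ^ 3 := pow_le_pow_right₀ hM (by norm_num)
  have hff : |f| * |f| ≤ M * M := by gcongr
  have t2 : |θ ^ 3 * (f * w)| ≤ θ ^ 3 * M ^ 3 := by
    rw [abs_mul, abs_mul, abs_of_pos (by positivity : 0 < θ ^ 3)]
    gcongr
    calc |f| * |w| ≤ M * M := by gcongr
      _ ≤ M ^ 3 := by linarith
  have t3 : |θ ^ 3 * (f * f * u / 2)| ≤ θ ^ 3 * M ^ 3 := by
    rw [abs_mul, abs_div, abs_mul, abs_mul, abs_of_pos (by positivity : 0 < θ ^ 3)]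
    gcongr
    have : |f| * |f| * |u| ≤ M * M * M := by gcongr
    have h2 : |(2:ℝ)| = 2 := by norm_num
    have h0 : 0 ≤ |f| * |f| * |u| := by positivity
    rw [h2]; nlinarith
  have t4 : |θ ^ 3 * (θ * (f * f * w) / 2)| ≤ θ ^ 3 * M ^ 3 := by
    rw [abs_mul, abs_div, abs_mul θ, abs_mul, abs_mul, abs_of_pos (by positivity : 0 < θ ^ 3), abs_of_pos hθ]
    gcongr
    have : |f| * |f| * |w| ≤ M * M * M := by gcongr
    have h0 : 0 ≤ |f| * |f| * |w| := by positivity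
    have h2 : |(2:ℝ)| = 2 := by norm_num
    have h3 : θ * (|f| * |f| * |w|) ≤ 1 * (|f| * |f| * |w|) := by gcongr
    rw [h2]; nlinarith
  have hp : 0 ≤ θ ^ 3 * M ^ 3 := by positivity
  have hh : (θ * M) ^ 3 * 3 = 3 * (θ ^ 3 * M ^ 3) := by ring
  rw [hh] at t1
  rw [abs_le] at t1 t2 t3 t4 ⊢
  constructor <;> linarith [t1.1, t1.2, t2.1, t2.2, t3.1, t3.2, t4.1, t4.2]

/-- The (rescaled) approximate exponential martingale function. -/
noncomputable def psi (u w : X → ℝ) (θ : ℝ) (x : X) (y : ℝ) : ℝ :=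
  (1 - Real.exp (-(θ * y)) * (1 - θ * u x + θ ^ 2 * w x)) / θ

theorem rho_bound {u w M θ : ℝ} (hu : |u| ≤ M) (hw : |w| ≤ M) (hM : 1 ≤ M)
    (hθ : 0 < θ) (hθM : θ * M ≤ 1) : |1 - θ * u + θ ^ 2 * w| ≤ 3 := by
  have hθ1 : θ ≤ 1 := by nlinarith
  have h1 : |θ * u| ≤ 1 := by rw [abs_mul, abs_of_pos hθ]; nlinarith
  have h2 : |θ ^ 2 * w| ≤ 1 := by
    rw [abs_mul, abs_of_pos (by positivity)]
    calc θ ^ 2 * |w| ≤ θ ^ 2 * M := by gcongr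
      _ = θ * (θ * M) := by ring
      _ ≤ 1 * 1 := by gcongr
      _ = 1 := by norm_num
  rw [abs_le] at *
  constructor <;> linarith [h1.1, h1.2, h2.1, h2.2]

theorem psi_near {u w : X → ℝ} {R θ : ℝ} (hu : ∀ x, |u x| ≤ R) (hw : ∀ x, |w x| ≤ R) (hR : 1 ≤ R)
    (hθ : 0 < θ) (hθR : θ * R ≤ 1) (x : X) {y : ℝ} (hy : |y| ≤ R) :
    |psi u w θ x y - (y + u x)| ≤ 6 * R ^ 2 * θ := by
  have hz : |-(θ * y)| ≤ θ * R := by rw [abs_neg, abs_mul, abs_of_pos hθ]; gcongr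
  have h1 := Real.abs_exp_sub_one_sub_id_le (hz.trans hθR)
  obtain ⟨E, hE⟩ : ∃ E, E = Real.exp (-(θ * y)) := ⟨_, rfl⟩
  have hE0 : 0 < E := by rw [hE]; exact Real.exp_pos _
  rw [← hE] at h1
  have hzz : (-(θ * y)) ^ 2 ≤ (θ * R) ^ 2 := by rw [← sq_abs]; gcongr
  have h2 : |E - 1 - -(θ * y)| ≤ (θ * R) ^ 2 := h1.trans hzz
  have hθR0 : 0 < θ * R := by positivity
  have hsq : (θ * R) ^ 2 ≤ θ * R := by nlinarith
  have h3 : |E - 1| ≤ 2 * (θ * R) := by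
    rw [abs_le] at *
    constructor <;> linarith [h2.1, h2.2, hz.1, hz.2]
  have hE3 : |E| ≤ 3 := by
    rw [abs_le] at *
    constructor <;> linarith [h3.2]
  have e : psi u w θ x y - (y + u x) =
      (-(E - 1 - -(θ * y)) + θ * u x * (E - 1) - θ ^ 2 * w x * E) / θ := by
    unfold psi; rw [← hE]; field_simp; ring
  rw [e, abs_div, abs_of_pos hθ, div_le_iff₀ hθ]
  have t2 : |θ * u x * (E - 1)| ≤ θ * R * (2 * (θ * R)) := by
    rw [abs_mul, abs_mul, abs_of_pos hθ]; gcongr; exact hu x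
  have t3 : |θ ^ 2 * w x * E| ≤ θ ^ 2 * R * 3 := by
    rw [abs_mul, abs_mul, abs_of_pos (by positivity : 0 < θ ^ 2)]; gcongr; exact hw x
  have hRR : θ ^ 2 * R ≤ θ ^ 2 * R ^ 2 := by gcongr; nlinarith
  have hid : 6 * R ^ 2 * θ * θ = 6 * (θ ^ 2 * R ^ 2) := by ring
  have hid2 : (θ * R) ^ 2 = θ ^ 2 * R ^ 2 := by ring
  have hid3 : θ * R * (2 * (θ * R)) = 2 * (θ ^ 2 * R ^ 2) := by ring
  rw [hid2] at h2
  rw [hid3] at t2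
  rw [hid]
  rw [abs_le] at h2 t2 t3 ⊢
  constructor <;> linarith [h2.1, h2.2, t2.1, t2.2, t3.1, t3.2]

theorem psi_le {u w : X → ℝ} {M θ : ℝ} (hu : ∀ x, |u x| ≤ M) (hw : ∀ x, |w x| ≤ M) (hM : 1 ≤ M)
    (hθ : 0 < θ) (hθM : θ * M ≤ 1) (x : X) {y : ℝ} (hy : 0 < y) :
    |psi u w θ x y| ≤ y + 2 * M := by
  obtain ⟨E, hE⟩ : ∃ E, E = Real.exp (-(θ * y)) := ⟨_, rfl⟩
  have hE0 : 0 < E := by rw [hE]; exact Real.exp_pos _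
  have hE1 : E ≤ 1 := by rw [hE, Real.exp_le_one_iff, neg_nonpos]; positivity
  have hE2 : 1 - θ * y ≤ E := by rw [hE]; linarith [Real.add_one_le_exp (-(θ * y))]
  have hθ1 : θ ≤ 1 := by nlinarith
  have e : psi u w θ x y = ((1 - E) + θ * (E * (u x - θ * w x))) / θ := by
    unfold psi; rw [← hE]; field_simp; ring
  rw [e, abs_div, abs_of_pos hθ, div_le_iff₀ hθ]
  have t : |E * (u x - θ * w x)| ≤ 2 * M := by
    have h2 : |θ * w x| ≤ M := by
      rw [abs_mul, abs_of_pos hθ]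
      calc θ * |w x| ≤ 1 * M := by gcongr; exact hw x
        _ = M := one_mul _
    have h3 : |u x - θ * w x| ≤ 2 * M := (abs_sub _ _).trans (by linarith [hu x])
    rw [abs_mul, abs_of_pos hE0]
    calc E * |u x - θ * w x| ≤ 1 * (2 * M) := by gcongr
      _ = _ := one_mul _
  rw [abs_le] at t ⊢
  constructor <;> nlinarith [t.1, t.2]

theorem psi_bdd {u w : X → ℝ} {M θ : ℝ} (hu : ∀ x, |u x| ≤ M) (hw : ∀ x, |w x| ≤ M) (hM : 1 ≤ M)
    (hθ : 0 < θ) (hθM : θ * M ≤ 1) (x : X) {y : ℝ} (hy : 0 < y) :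
    |psi u w θ x y| ≤ 4 / θ := by
  unfold psi
  rw [abs_div, abs_of_pos hθ]
  gcongr
  have hE1 : Real.exp (-(θ * y)) ≤ 1 := by rw [Real.exp_le_one_iff, neg_nonpos]; positivity
  have := rho_bound (hu x) (hw x) hM hθ hθM
  have t : |Real.exp (-(θ * y)) * (1 - θ * u x + θ ^ 2 * w x)| ≤ 1 * 3 := by
    rw [abs_mul, abs_of_pos (Real.exp_pos _)]; gcongr
  refine (abs_sub _ _).trans ?_
  rw [abs_one]; linarith

theorem psi_res [Fintype X] {P : X → X → ℝ} {f u w : X → ℝ} {M l : ℝ} (hP : ∀ x x', 0 ≤ P x x')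
    (hrow : ∀ x, ∑ x', P x x' = 1)
    (hf : ∀ x, |f x| ≤ M) (hu : ∀ x, |u x| ≤ M) (hw : ∀ x, |w x| ≤ M) (hM : 1 ≤ M) (hl : 0 < l)
    (e1 : ∀ x, ∑ x', P x x' * (f x' + u x') = u x)
    (e2 : ∀ x, ∑ x', P x x' * (f x' ^ 2 / 2 + f x' * u x' + w x') = w x + l) :
    ∃ C > 0, ∀ θ, 0 < θ → θ * M ≤ 1 → l * θ ^ 2 ≤ 1 → ∀ x y, 0 < y →
      |(psi u w θ - Real.exp (-(l * θ ^ 2)) • Kop P f (psi u w θ) - 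
        Real.exp (-(l * θ ^ 2)) • Bop P f (psi u w θ)) x y - l * θ| ≤ C * θ ^ 2 := by
  obtain ⟨c, hc⟩ : ∃ c, c = 2 * M + l + 10 * M ^ 3 := ⟨_, rfl⟩
  have hc0 : 0 < c := by rw [hc]; positivity
  refine ⟨10 * M ^ 3 + l ^ 2 * (1 + c) + l * c + l ^ 2, by positivity, ?_⟩
  intro θ hθ hθM hlθ x y hy
  have hθ1 : θ ≤ 1 := by nlinarith
  obtain ⟨s, hs⟩ : ∃ s, s = Real.exp (-(l * θ ^ 2)) := ⟨_, rfl⟩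
  rw [← hs]
  have hs2 : |s - 1 + l * θ ^ 2| ≤ l ^ 2 * θ ^ 4 := by
    have := Real.abs_exp_sub_one_sub_id_le (x := -(l * θ ^ 2)) (by
      rw [abs_neg, abs_of_nonneg (by positivity)]; exact hlθ)
    rw [← hs] at this
    calc |s - 1 + l * θ ^ 2| = |s - 1 - -(l * θ ^ 2)| := by congr 1; ring
      _ ≤ _ := this
      _ = _ := by ring
  obtain ⟨A, hA⟩ : ∃ A, A = ∑ x', P x x' * (Real.exp (-(θ * f x')) * (1 - θ * u x' + θ ^ 2 * w x')) := ⟨_, rfl⟩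
  have hAe : |A - (1 - θ * u x + θ ^ 2 * (w x + l))| ≤ 10 * M ^ 3 * θ ^ 3 := by
    have h1 : 1 - θ * u x + θ ^ 2 * (w x + l) = 
      ∑ x', P x x' * (1 - θ * (f x' + u x') + θ ^ 2 * (f x' ^ 2 / 2 + f x' * u x' + w x')) := by
      conv_lhs => rw [← e1 x, ← e2 x, ← hrow x]
      rw [Finset.mul_sum, Finset.mul_sum, ← Finset.sum_sub_distrib, ← Finset.sum_add_distrib]
      exact Finset.sum_congr rfl fun x' _ => by ring
    rw [hA, h1, ← Finset.sum_sub_distrib]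
    refine (Finset.abs_sum_le_sum_abs _ _).trans ?_
    calc _ ≤ ∑ x', P x x' * (10 * M ^ 3 * θ ^ 3) := by
          refine Finset.sum_le_sum fun x' _ => ?_
          rw [← mul_sub, abs_mul, abs_of_nonneg (hP x x')]
          exact mul_le_mul_of_nonneg_left (expansion (hf x') (hu x') (hw x') hM hθ hθM) (hP x x')
      _ = _ := by rw [← Finset.sum_mul, hrow, one_mul]
  obtain ⟨R, hR⟩ : ∃ R, R = A - (1 - θ * u x + θ ^ 2 * (w x + l)) := ⟨_, rfl⟩
  rw [← hR] at hAe
  have hA1 : |A - 1| ≤ c * θ := by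
    have h1 : |θ * u x| ≤ θ * M := by rw [abs_mul, abs_of_pos hθ]; gcongr; exact hu x
    have h2 : |θ ^ 2 * (w x + l)| ≤ θ * (M + l) := by
      rw [abs_mul, abs_of_pos (by positivity : 0 < θ ^ 2)]
      have : |w x + l| ≤ M + l := (abs_add_le _ _).trans (by rw [abs_of_pos hl]; linarith [hw x])
      have h3 : θ ^ 2 ≤ θ := by nlinarith
      gcongr
    have h3 : θ ^ 3 ≤ θ := by nlinarith [pow_le_one₀ (n := 2) hθ.le hθ1]
    have h4 : 10 * M ^ 3 * θ ^ 3 ≤ 10 * M ^ 3 * θ := by gcongr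
    have e : A - 1 = R - θ * u x + θ ^ 2 * (w x + l) := by rw [hR]; ring
    rw [e, hc]
    rw [abs_le] at hAe h1 h2 ⊢
    constructor <;> linarith [hAe.1, hAe.2, h1.1, h1.2, h2.1, h2.2]
  have hAb : |A| ≤ 1 + c := by
    have : c * θ ≤ c := by nlinarith
    rw [abs_le] at hA1 ⊢
    constructor <;> linarith [hA1.1, hA1.2]
  have hbr : |(1 - θ * u x + θ ^ 2 * w x) - s * A| ≤ (10 * M ^ 3 + l ^ 2 * (1 + c) + l * c) * θ ^ 3 := by
    have e : (1 - θ * u x + θ ^ 2 * w x) - s * A = 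
      -R - (s - 1 + l * θ ^ 2) * A + l * θ ^ 2 * (A - 1) := by rw [hR]; ring
    have t2 : |(s - 1 + l * θ ^ 2) * A| ≤ l ^ 2 * θ ^ 4 * (1 + c) := by rw [abs_mul]; gcongr
    have t3 : |l * θ ^ 2 * (A - 1)| ≤ l * θ ^ 2 * (c * θ) := by
      rw [abs_mul, abs_of_pos (by positivity : 0 < l * θ ^ 2)]; gcongr
    have t4 : l ^ 2 * θ ^ 4 * (1 + c) ≤ l ^ 2 * (1 + c) * θ ^ 3 := by
      have : θ ^ 4 ≤ θ ^ 3 := pow_le_pow_of_le_one hθ.le hθ1 (by norm_num)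
      calc l ^ 2 * θ ^ 4 * (1 + c) ≤ l ^ 2 * θ ^ 3 * (1 + c) := by gcongr
        _ = _ := by ring
    rw [e]
    rw [abs_le] at hAe t2 t3 ⊢
    constructor <;> linarith [hAe.1, hAe.2, t2.1, t2.2, t3.1, t3.2]
  have hQ : Kop P f (psi u w θ) x y + Bop P f (psi u w θ) x y = (1 - Real.exp (-(θ * y)) * A) / θ := by
    have h1 : (1 - Real.exp (-(θ * y)) * A) / θ = (∑ x', P x x' - Real.exp (-(θ * y)) * A) / θ := by
      rw [hrow x]
    rw [h1, KB_apply, hA, Finset.mul_sum, ← Finset.sum_sub_distrib, Finset.sum_div]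
    refine Finset.sum_congr rfl fun x' _ => ?_
    have h2 : Real.exp (-(θ * (y + f x'))) = Real.exp (-(θ * y)) * Real.exp (-(θ * f x')) := by
      rw [← Real.exp_add]; congr 1; ring
    unfold psi
    rw [h2]; ring
  simp only [Pi.sub_apply, Pi.smul_apply, smul_eq_mul]
  have e : psi u w θ x y - s * Kop P f (psi u w θ) x y - s * Bop P f (psi u w θ) x y - l * θ =
      -((s - 1 + l * θ ^ 2) + Real.exp (-(θ * y)) * ((1 - θ * u x + θ ^ 2 * w x) - s * A)) / θ := by
    rw [sub_sub (psi u w θ x y), ← mul_add, hQ]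
    unfold psi; field_simp; ring
  rw [e, abs_div, abs_neg, abs_of_pos hθ, div_le_iff₀ hθ]
  have hE1 : Real.exp (-(θ * y)) ≤ 1 := by rw [Real.exp_le_one_iff, neg_nonpos]; positivity
  have t1 : |Real.exp (-(θ * y)) * ((1 - θ * u x + θ ^ 2 * w x) - s * A)| ≤ 
      1 * ((10 * M ^ 3 + l ^ 2 * (1 + c) + l * c) * θ ^ 3) := by
    rw [abs_mul, abs_of_pos (Real.exp_pos _)]; gcongr
  have t4 : l ^ 2 * θ ^ 4 ≤ l ^ 2 * θ ^ 3 := by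
    have : θ ^ 4 ≤ θ ^ 3 := pow_le_pow_of_le_one hθ.le hθ1 (by norm_num)
    gcongr
  refine (abs_add_le _ _).trans ?_
  nlinarith

theorem exp_pow_eq (δ : ℝ) (n : ℕ) : Real.exp (-δ) ^ n = Real.exp (-(δ * n)) := by
  rw [← Real.exp_nat_mul]; congr 1; ring

/-- Generating function of the survival probabilities. -/
noncomputable def Gam [Fintype X] (P : X → X → ℝ) (f : X → ℝ) (δ : ℝ) (x : X) (y : ℝ) : ℝ :=
  ∑' n : ℕ, qs P f n x y * Real.exp (-(δ * n))

theorem Gam_summable [Fintype X] {P : X → X → ℝ} {f : X → ℝ} (hP : ∀ x x', 0 ≤ P x x')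
    (hrow : ∀ x, ∑ x', P x x' = 1) {δ : ℝ} (hδ : 0 < δ) (x : X) (y : ℝ) :
    Summable fun n : ℕ => qs P f n x y * Real.exp (-(δ * n)) :=
  Summable.of_nonneg_of_le (fun n => mul_nonneg (qs_nonneg hP n x y) (Real.exp_pos _).le)
    (fun n => mul_le_of_le_one_left (Real.exp_pos _).le (qs_le_one hP hrow n x y)) (summable_exp hδ)

/-- Expected (discounted) value at the exit. -/
noncomputable def be [Fintype X] (P : X → X → ℝ) (f u : X → ℝ) (n : ℕ) (x : X) (y : ℝ) : ℝ :=
  ((Kop P f) ^ n) (Bop P f (fun x y => y + u x)) x y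

theorem Bop_abs [Fintype X] {P : X → X → ℝ} {f : X → ℝ} {M C : ℝ} (hP : ∀ x x', 0 ≤ P x x')
    (hf : ∀ x, |f x| ≤ M) {φ : X → ℝ → ℝ} (h : ∀ x y, |y| ≤ M → |φ x y| ≤ C) (x : X) (y : ℝ) (hy : 0 < y) :
    |Bop P f φ x y| ≤ (C • Bop P f (fun _ _ => 1)) x y := by
  simp only [Pi.smul_apply, smul_eq_mul]
  rw [Bop_apply, Bop_apply, Finset.mul_sum]
  refine (Finset.abs_sum_le_sum_abs _ _).trans (Finset.sum_le_sum fun x' _ => ?_)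
  rw [abs_mul, abs_of_nonneg (hP x x')]
  by_cases h' : y + f x' ≤ 0
  · rw [ind_true h', one_mul, mul_one, mul_one, mul_comm]
    refine mul_le_mul_of_nonneg_right (h _ _ ?_) (hP _ _)
    have := abs_le.mp (hf x')
    rw [abs_le]; constructor <;> linarith [this.1, this.2]
  · rw [ind_false h']; simp

theorem be_abs [Fintype X] {P : X → X → ℝ} {f u : X → ℝ} {M : ℝ} (hP : ∀ x x', 0 ≤ P x x')
    (hf : ∀ x, |f x| ≤ M) (hu : ∀ x, |u x| ≤ M) (n : ℕ) (x : X) (y : ℝ) (hy : 0 < y) :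
    |be P f u n x y| ≤ 2 * M * ps P f n x y := by
  have h := Kpow_abs (f := f) hP (φ := Bop P f (fun x y => y + u x)) (ψ := (2 * M) • Bop P f (fun _ _ => 1))
    (fun x y hy => Bop_abs hP hf (fun x y hy => (abs_add_le _ _).trans (by linarith [hu x])) x y hy) n x y hy
  rw [map_smul] at h
  exact h

theorem main_est [Fintype X] {P : X → X → ℝ} {f u w : X → ℝ} {M l : ℝ} (hP : ∀ x x', 0 ≤ P x x')
    (hrow : ∀ x, ∑ x', P x x' = 1)
    (hf : ∀ x, |f x| ≤ M) (hu : ∀ x, |u x| ≤ M) (hw : ∀ x, |w x| ≤ M) (hM : 1 ≤ M) (hl : 0 < l)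
    (e1 : ∀ x, ∑ x', P x x' * (f x' + u x') = u x)
    (e2 : ∀ x, ∑ x', P x x' * (f x' ^ 2 / 2 + f x' * u x' + w x') = w x + l) :
    ∃ C > 0, ∀ θ, 0 < θ → θ * M ≤ 1 → l * θ ^ 2 ≤ 1 → ∀ x y, 0 < y →
      |psi u w θ x y - l * θ * Gam P f (l * θ ^ 2) x y -
        ∑' n : ℕ, Real.exp (-(l * θ ^ 2)) ^ (n + 1) * be P f u n x y| ≤
      C * θ ^ 2 * Gam P f (l * θ ^ 2) x y + C * θ := by
  obtain ⟨C1, hC1, hres⟩ := psi_res hP hrow hf hu hw hM hl e1 e2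
  refine ⟨C1 + 6 * M ^ 2, by positivity, ?_⟩
  intro θ hθ hθM hlθ x y hy
  have hres := hres θ hθ hθM hlθ
  have hδ : 0 < l * θ ^ 2 := by positivity
  obtain ⟨s, hs⟩ : ∃ s, s = Real.exp (-(l * θ ^ 2)) := ⟨_, rfl⟩
  rw [← hs] at hres ⊢
  have hs0 : 0 < s := by rw [hs]; exact Real.exp_pos _
  have hs1 : s < 1 := by rw [hs, Real.exp_lt_one_iff]; linarith
  have hspow : ∀ n : ℕ, s ^ n = Real.exp (-(l * θ ^ 2 * n)) := fun n => by rw [hs, exp_pow_eq]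
  set ψ := psi u w θ with hψ
  -- residual terms
  have r1 : ∀ n, |((Kop P f) ^ n) (ψ - s • Kop P f ψ - s • Bop P f ψ) x y - l * θ * qs P f n x y| ≤
      C1 * θ ^ 2 * qs P f n x y := by
    intro n
    have h := Kpow_abs (f := f) hP (φ := (ψ - s • Kop P f ψ - s • Bop P f ψ) - (l * θ) • (fun _ _ => 1))
      (ψ := (C1 * θ ^ 2) • (fun _ _ => 1)) (fun x y hy => by
        have := hres x y hy
        simpa using this) n x y hy
    rw [map_sub, map_smul, map_smul] at h
    exact h
  have r2 : ∀ n, |((Kop P f) ^ n) (Bop P f ψ) x y - be P f u n x y| ≤ 6 * M ^ 2 * θ * ps P f n x y := by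
    intro n
    have h := Kpow_abs (f := f) hP (φ := Bop P f (ψ - fun x y => y + u x))
      (ψ := (6 * M ^ 2 * θ) • Bop P f (fun _ _ => 1)) (fun x y hy => 
        Bop_abs hP hf (fun x y hy => psi_near hu hw hM hθ hθM x hy) x y hy) n x y hy
    rw [map_sub, map_sub, map_smul] at h
    exact h
  have r3 : ∀ n, |((Kop P f) ^ n) ψ x y| ≤ 4 / θ := by
    intro n
    have h := Kpow_abs (f := f) hP (φ := ψ) (ψ := (4 / θ) • (fun _ _ => 1)) (fun x y hy => by
        simpa using psi_bdd hu hw hM hθ hθM x hy) n x y hy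
    rw [map_smul] at h
    refine h.trans ?_
    have := qs_le_one (f := f) hP hrow n x y
    calc _ = 4 / θ * qs P f n x y := rfl
      _ ≤ 4 / θ * 1 := by gcongr
      _ = _ := mul_one _
  have hGs := Gam_summable (f := f) hP hrow hδ x y
  have hps := ps_summable (f := f) hP hrow x y
  have hbs : Summable fun n : ℕ => s ^ (n + 1) * be P f u n x y := by
    refine Summable.of_norm_bounded (hps.mul_left (2 * M)) fun n => ?_
    rw [norm_mul, Real.norm_eq_abs, Real.norm_eq_abs, abs_of_pos (by positivity)]
    have h1 := be_abs hP hf hu n x y hy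
    have h2 : s ^ (n + 1) ≤ 1 := pow_le_one₀ hs0.le hs1.le
    calc _ ≤ 1 * |be P f u n x y| := by gcongr
      _ ≤ _ := by rw [one_mul]; exact h1
  have hfin : ∀ N, |ψ x y - s ^ N * ((Kop P f) ^ N) ψ x y - l * θ * ∑ n ∈ range N, qs P f n x y * Real.exp (-(l * θ ^ 2 * n))
      - ∑ n ∈ range N, s ^ (n + 1) * be P f u n x y| ≤
      (C1 + 6 * M ^ 2) * θ ^ 2 * Gam P f (l * θ ^ 2) x y + (C1 + 6 * M ^ 2) * θ := by
    intro N
    have ht := telescope P f ψ s x y N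
    have e : ψ x y - s ^ N * ((Kop P f) ^ N) ψ x y - l * θ * ∑ n ∈ range N, qs P f n x y * Real.exp (-(l * θ ^ 2 * n))
      - ∑ n ∈ range N, s ^ (n + 1) * be P f u n x y = 
      ∑ n ∈ range N, (s ^ n * (((Kop P f) ^ n) (ψ - s • Kop P f ψ - s • Bop P f ψ) x y - l * θ * qs P f n x y)
        + s ^ (n + 1) * (((Kop P f) ^ n) (Bop P f ψ) x y - be P f u n x y)) := by
      have h1 : ψ x y - s ^ N * ((Kop P f) ^ N) ψ x y = ∑ n ∈ range N, (s ^ n * ((Kop P f) ^ n) (ψ - s • Kop P f ψ - s • Bop P f ψ) x y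
      + s ^ (n + 1) * ((Kop P f) ^ n) (Bop P f ψ) x y) := by linarith
      rw [h1, Finset.mul_sum, ← Finset.sum_sub_distrib, ← Finset.sum_sub_distrib]
      refine Finset.sum_congr rfl fun n _ => ?_
      rw [← hspow]; ring
    rw [e]
    have b1 : ∑ n ∈ range N, qs P f n x y * Real.exp (-(l * θ ^ 2 * n)) ≤ Gam P f (l * θ ^ 2) x y :=
      hGs.sum_le_tsum _ fun n _ => mul_nonneg (qs_nonneg hP n x y) (Real.exp_pos _).le
    have b2 := ps_sum_le (f := f) hP hrow N x y
    have hG0 : 0 ≤ Gam P f (l * θ ^ 2) x y := tsum_nonneg fun n => mul_nonneg (qs_nonneg hP n x y) (Real.exp_pos _).le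
    calc _ ≤ ∑ n ∈ range N, (C1 * θ ^ 2 * (qs P f n x y * Real.exp (-(l * θ ^ 2 * n))) + 6 * M ^ 2 * θ * ps P f n x y) := by
          refine (Finset.abs_sum_le_sum_abs _ _).trans (Finset.sum_le_sum fun n _ => ?_)
          refine (abs_add_le _ _).trans ?_
          rw [abs_mul, abs_mul, abs_of_pos (by positivity : 0 < s ^ n), abs_of_pos (by positivity : 0 < s ^ (n+1)), ← hspow]
          have h2 : s ^ (n + 1) ≤ 1 := pow_le_one₀ hs0.le hs1.le
          have t1 := mul_le_mul_of_nonneg_left (r1 n) (by positivity : 0 ≤ s ^ n)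
          have t2 := mul_le_mul h2 (r2 n) (abs_nonneg _) zero_le_one
          linarith
      _ = C1 * θ ^ 2 * (∑ n ∈ range N, qs P f n x y * Real.exp (-(l * θ ^ 2 * n))) + 6 * M ^ 2 * θ * ∑ n ∈ range N, ps P f n x y := by
          rw [Finset.sum_add_distrib, ← Finset.mul_sum, ← Finset.mul_sum]
      _ ≤ C1 * θ ^ 2 * Gam P f (l * θ ^ 2) x y + 6 * M ^ 2 * θ * 1 := by gcongr
      _ ≤ _ := by
          have t1 : 0 ≤ 6 * M ^ 2 * θ ^ 2 * Gam P f (l * θ ^ 2) x y := by positivity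
          have t2 : 0 ≤ C1 * θ := by positivity
          linarith
  have hlim0 : Tendsto (fun N : ℕ => s ^ N * ((Kop P f) ^ N) ψ x y) atTop (𝓝 0) := by
    have h1 : Tendsto (fun N : ℕ => s ^ N * (4 / θ)) atTop (𝓝 0) := by
      simpa using (tendsto_pow_atTop_nhds_zero_of_lt_one hs0.le hs1).mul_const (4 / θ)
    refine squeeze_zero_norm (fun N => ?_) h1
    rw [norm_mul, Real.norm_eq_abs, Real.norm_eq_abs, abs_of_pos (by positivity)]
    gcongr
    exact r3 N
  have hlim := (((tendsto_const_nhds (x := ψ x y)).sub hlim0).sub (hGs.hasSum.tendsto_sum_nat.const_mul (l * θ))).sub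
    hbs.hasSum.tendsto_sum_nat
  have := le_of_tendsto' hlim.abs hfin
  rw [sub_zero] at this
  exact this

theorem W_le [Fintype X] {P : X → X → ℝ} {f u : X → ℝ} {M : ℝ} (hP : ∀ x x', 0 ≤ P x x')
    (hrow : ∀ x, ∑ x', P x x' = 1) (hM : 1 ≤ M)
    (hf : ∀ x, |f x| ≤ M) (hu : ∀ x, |u x| ≤ M) {s : ℝ} (h0 : 0 ≤ s) (h1 : s ≤ 1) (x : X) (y : ℝ)
    (hy : 0 < y) : |∑' n : ℕ, s ^ (n + 1) * be P f u n x y| ≤ 2 * M := by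
  have hb : ∀ n : ℕ, ‖s ^ (n + 1) * be P f u n x y‖ ≤ 2 * M * ps P f n x y := by
    intro n
    rw [Real.norm_eq_abs, abs_mul, abs_of_nonneg (pow_nonneg h0 _)]
    exact (mul_le_of_le_one_left (abs_nonneg _) (pow_le_one₀ h0 h1)).trans (be_abs hP hf hu n x y hy)
  have hs := (ps_summable (f := f) hP hrow x y).mul_left (2 * M)
  have := tsum_of_norm_bounded hs.hasSum hb
  rw [Real.norm_eq_abs, tsum_mul_left] at this
  have h2 : ∑' n, ps P f n x y ≤ 1 :=
    Real.tsum_le_of_sum_range_le (fun n => ps_nonneg hP hrow n x y) fun N => ps_sum_le hP hrow N x y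
  nlinarith

theorem Gam_nonneg [Fintype X] {P : X → X → ℝ} {f : X → ℝ} (hP : ∀ x x', 0 ≤ P x x')
    (δ : ℝ) (x : X) (y : ℝ) : 0 ≤ Gam P f δ x y :=
  tsum_nonneg fun n => mul_nonneg (qs_nonneg hP n x y) (Real.exp_pos _).le

theorem Gam_bound [Fintype X] {P : X → X → ℝ} {f u w : X → ℝ} {M l : ℝ} (hP : ∀ x x', 0 ≤ P x x')
    (hrow : ∀ x, ∑ x', P x x' = 1)
    (hf : ∀ x, |f x| ≤ M) (hu : ∀ x, |u x| ≤ M) (hw : ∀ x, |w x| ≤ M) (hM : 1 ≤ M) (hl : 0 < l)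
    (e1 : ∀ x, ∑ x', P x x' * (f x' + u x') = u x)
    (e2 : ∀ x, ∑ x', P x x' * (f x' ^ 2 / 2 + f x' * u x' + w x') = w x + l) :
    ∃ C > 0, ∃ θ₀ > 0, ∀ θ, 0 < θ → θ ≤ θ₀ → ∀ x y, 0 < y →
      θ * Gam P f (l * θ ^ 2) x y ≤ C * (1 + y) ∧
      |psi u w θ x y - l * (θ * Gam P f (l * θ ^ 2) x y) -
        ∑' n : ℕ, Real.exp (-(l * θ ^ 2)) ^ (n + 1) * be P f u n x y| ≤ C * (1 + y) * θ := by
  obtain ⟨C, hC, H⟩ := main_est hP hrow hf hu hw hM hl e1 e2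
  obtain ⟨D, hD⟩ : ∃ D, D = 2 / l * (4 * M + l + 1) := ⟨_, rfl⟩
  have hDpos : 0 < D := by rw [hD]; positivity
  refine ⟨D + C * D + C, by positivity, 1 / (M + l + 2 * C / l + 1), by positivity, ?_⟩
  intro θ hθ hθ0 x y hy
  have hq : 0 < 2 * C / l := by positivity
  have hθ1 : θ * (M + l + 2 * C / l + 1) ≤ 1 := by
    rwa [le_div_iff₀ (by positivity)] at hθ0
  have a1 : 0 < θ * M := by positivity
  have a2 : 0 < θ * l := by positivity
  have a3 : 0 < θ * (2 * C / l) := by positivity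
  have hθM : θ * M ≤ 1 := by nlinarith
  have hθ2 : θ ≤ 1 := by nlinarith
  have hθl : θ * l ≤ 1 := by nlinarith
  have hθq : θ * (2 * C / l) ≤ 1 := by nlinarith
  have hθl2 : l * θ ^ 2 ≤ 1 := by nlinarith
  have hθC : 2 * C * θ ≤ l := by
    have : 2 * C * θ = θ * (2 * C / l) * l := by field_simp
    rw [this]; nlinarith
  have h := H θ hθ hθM hθl2 x y hy
  have hW := W_le (f := f) (u := u) hP hrow hM hf hu (Real.exp_pos (-(l * θ ^ 2))).le
    (Real.exp_le_one_iff.2 (by nlinarith [sq_nonneg θ])) x y hy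
  have hψ := psi_le hu hw hM hθ hθM x hy
  have hG0 := Gam_nonneg (f := f) hP (l * θ ^ 2) x y
  generalize Gam P f (l * θ ^ 2) x y = G at *
  generalize (∑' n : ℕ, Real.exp (-(l * θ ^ 2)) ^ (n + 1) * be P f u n x y) = W at *
  have hG : 0 ≤ θ * G := by positivity
  have hmain : θ * G ≤ D * (1 + y) := by
    have b1 : l * (θ * G) ≤ y + 2 * M + 2 * M + l / 2 * (θ * G) + l / 2 := by
      have c1 := (abs_le.1 h).1
      have c2 := (abs_le.1 hW).1
      have c3 := (abs_le.1 hψ).2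
      have c4 : C * θ ^ 2 * G ≤ l / 2 * (θ * G) := by
        have : C * θ ^ 2 * G = C * θ * (θ * G) := by ring
        rw [this]; gcongr; linarith
      linarith
    have b2 : θ * G ≤ 2 / l * (y + 4 * M + l / 2) := by
      rw [div_mul_eq_mul_div, le_div_iff₀ hl]; linarith
    refine b2.trans ?_
    rw [hD, mul_assoc]
    gcongr
    nlinarith
  constructor
  · nlinarith [mul_pos hC hDpos]
  · have e : l * (θ * G) = l * θ * G := by ring
    rw [e]
    refine h.trans ?_
    have : C * θ ^ 2 * G = C * θ * (θ * G) := by ring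
    rw [this]
    have : C * θ * (θ * G) ≤ C * θ * (D * (1 + y)) := by gcongr
    have h5 : 0 < D * (1 + y) * θ := by positivity
    have h6 : 0 < C * θ * y := by positivity
    nlinarith

theorem Gam_tendsto [Fintype X] {P : X → X → ℝ} {f u w : X → ℝ} {M l : ℝ} (hP : ∀ x x', 0 ≤ P x x')
    (hrow : ∀ x, ∑ x', P x x' = 1)
    (hf : ∀ x, |f x| ≤ M) (hu : ∀ x, |u x| ≤ M) (hw : ∀ x, |w x| ≤ M) (hM : 1 ≤ M) (hl : 0 < l)
    (e1 : ∀ x, ∑ x', P x x' * (f x' + u x') = u x)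
    (e2 : ∀ x, ∑ x', P x x' * (f x' ^ 2 / 2 + f x' * u x' + w x') = w x + l) (x : X) (y : ℝ)
    (hy : 0 < y) : ∃ L, Tendsto (fun θ : ℝ => θ * Gam P f (l * θ ^ 2) x y) (𝓝[>] 0) (𝓝 L) := by
  obtain ⟨C, hC, θ₀, hθ₀, H⟩ := Gam_bound hP hrow hf hu hw hM hl e1 e2
  have hid : Tendsto (fun θ : ℝ => θ) (𝓝[>] 0) (𝓝 0) := tendsto_id.mono_left nhdsWithin_le_nhds
  have hpos : ∀ᶠ θ : ℝ in 𝓝[>] 0, 0 < θ := eventually_mem_nhdsWithin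
  have hψ : Tendsto (fun θ => psi u w θ x y) (𝓝[>] 0) (𝓝 (y + u x)) := by
    rw [tendsto_iff_norm_sub_tendsto_zero]
    obtain ⟨R, hR⟩ : ∃ R, R = max M y := ⟨_, rfl⟩
    have hMR : M ≤ R := hR ▸ le_max_left _ _
    have hyR : |y| ≤ R := by rw [abs_of_pos hy, hR]; exact le_max_right _ _
    have hsm : ∀ᶠ θ : ℝ in 𝓝[>] 0, θ < 1 / R := hid.eventually_lt_const (one_div_pos.2 (by linarith))
    refine squeeze_zero' (Eventually.of_forall fun _ => norm_nonneg _) (g := fun θ => 6 * R ^ 2 * θ) ?_ ?_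
    · filter_upwards [hpos, hsm] with θ h1 h2
      rw [lt_div_iff₀ (by linarith)] at h2
      exact psi_near (fun x => (hu x).trans hMR) (fun x => (hw x).trans hMR) (hM.trans hMR) h1 h2.le x hyR
    · simpa using hid.const_mul (6 * R ^ 2)
  have hW : Tendsto (fun θ : ℝ => ∑' n : ℕ, Real.exp (-(l * θ ^ 2)) ^ (n + 1) * be P f u n x y) (𝓝[>] 0)
      (𝓝 (∑' n : ℕ, be P f u n x y)) := by
    refine tendsto_tsum_of_dominated_convergence (bound := fun n => 2 * M * ps P f n x y)
      ((ps_summable (f := f) hP hrow x y).mul_left (2 * M)) ?_ ?_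
    · intro n
      have hc : Continuous fun θ : ℝ => Real.exp (-(l * θ ^ 2)) ^ (n + 1) * be P f u n x y := by fun_prop
      have := (hc.tendsto 0).mono_left (nhdsWithin_le_nhds (s := Set.Ioi 0))
      simpa using this
    · filter_upwards with θ n
      rw [Real.norm_eq_abs, abs_mul, abs_of_nonneg (pow_nonneg (Real.exp_pos _).le _)]
      exact (mul_le_of_le_one_left (abs_nonneg _) (pow_le_one₀ (Real.exp_pos _).le
        (Real.exp_le_one_iff.2 (by nlinarith [sq_nonneg θ])))).trans (be_abs hP hf hu n x y hy)
  have hE : Tendsto (fun θ : ℝ => psi u w θ x y - l * (θ * Gam P f (l * θ ^ 2) x y) -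
        ∑' n : ℕ, Real.exp (-(l * θ ^ 2)) ^ (n + 1) * be P f u n x y) (𝓝[>] 0) (𝓝 0) := by
    rw [tendsto_zero_iff_norm_tendsto_zero]
    refine squeeze_zero' (Eventually.of_forall fun _ => norm_nonneg _) (g := fun θ => C * (1 + y) * θ) ?_ ?_
    · filter_upwards [hpos, hid.eventually_lt_const hθ₀] with θ h1 h2
      exact (H θ h1 h2.le x y hy).2
    · simpa using hid.const_mul (C * (1 + y))
  refine ⟨_, (((hψ.sub hW).sub hE).div_const l).congr fun θ => ?_⟩
  field_simp
  ring

theorem qs_tendsto_pos [Fintype X] {P : X → X → ℝ} {f u w : X → ℝ} {M l : ℝ} (hP : ∀ x x', 0 ≤ P x x')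
    (hrow : ∀ x, ∑ x', P x x' = 1)
    (hf : ∀ x, |f x| ≤ M) (hu : ∀ x, |u x| ≤ M) (hw : ∀ x, |w x| ≤ M) (hM : 1 ≤ M) (hl : 0 < l)
    (e1 : ∀ x, ∑ x', P x x' * (f x' + u x') = u x)
    (e2 : ∀ x, ∑ x', P x x' * (f x' ^ 2 / 2 + f x' * u x' + w x') = w x + l) (x : X) (y : ℝ)
    (hy : 0 < y) : ∃ L, 0 ≤ L ∧ Tendsto (fun n : ℕ => √n * qs P f n x y) atTop (𝓝 L) := by
  obtain ⟨L, hL⟩ := Gam_tendsto hP hrow hf hu hw hM hl e1 e2 x y hy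
  have hg : Tendsto (fun δ : ℝ => √(δ / l)) (𝓝[>] 0) (𝓝[>] 0) := by
    refine tendsto_nhdsWithin_iff.2 ⟨?_, ?_⟩
    · have hc : Continuous fun δ : ℝ => √(δ / l) := by fun_prop
      have := (hc.tendsto 0).mono_left (nhdsWithin_le_nhds (s := Set.Ioi 0))
      simpa using this
    · filter_upwards [self_mem_nhdsWithin] with δ hδ
      exact Real.sqrt_pos.2 (div_pos hδ hl)
  refine tauber (a := fun n => qs P f n x y) (L := √l * L) (qs_antitone hP hrow x y) (fun n => qs_nonneg hP n x y) ?_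
  refine ((hL.comp hg).const_mul (√l)).congr' ?_
  filter_upwards [self_mem_nhdsWithin] with δ hδ
  have hδ : 0 < δ := hδ
  simp only [Function.comp]
  rw [Real.sq_sqrt (by positivity), mul_div_cancel₀ _ hl.ne', ← mul_assoc, ← Real.sqrt_mul hl.le,
    mul_div_cancel₀ _ hl.ne']
  rfl

theorem qs_tendsto [Fintype X] {P : X → X → ℝ} {f : X → ℝ} (hP : ∀ x x', 0 ≤ P x x')
    (H : ∀ x y, 0 < y → ∃ L, 0 ≤ L ∧ Tendsto (fun n : ℕ => √n * qs P f n x y) atTop (𝓝 L)) (x : X) (y : ℝ) :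
    ∃ L, 0 ≤ L ∧ Tendsto (fun n : ℕ => √n * qs P f n x y) atTop (𝓝 L) := by
  have H' : ∀ x', ∃ L, 0 ≤ L ∧
      Tendsto (fun n : ℕ => √(n + 1 : ℕ) * (ind (0 < y + f x') * qs P f n x' (y + f x'))) atTop (𝓝 L) := by
    intro x'
    by_cases h : 0 < y + f x'
    · obtain ⟨L, hL0, hL⟩ := H x' _ h
      refine ⟨L, hL0, ?_⟩
      have hr : Tendsto (fun n : ℕ => √(1 + 1 / (n : ℝ))) atTop (𝓝 1) := by
        have h3 : Tendsto (fun n : ℕ => (1 : ℝ) + 1 / (n : ℝ)) atTop (𝓝 (1 + 0)) :=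
          tendsto_const_nhds.add tendsto_one_div_atTop_nhds_zero_nat
        have := h3.sqrt
        simpa using this
      have := hr.mul hL
      rw [one_mul] at this
      refine this.congr' ?_
      filter_upwards [eventually_gt_atTop 0] with n hn
      have hn' : (0 : ℝ) < n := by exact_mod_cast hn
      rw [ind_true h, one_mul, ← mul_assoc, ← Real.sqrt_mul (by positivity)]
      congr 2
      push_cast
      field_simp
    · refine ⟨0, le_rfl, ?_⟩
      simp [ind_false h]
  choose L hL0 hL using H'
  refine ⟨∑ x', P x x' * L x', Finset.sum_nonneg fun x' _ => mul_nonneg (hP _ _) (hL0 _), ?_⟩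
  rw [← tendsto_add_atTop_iff_nat 1]
  refine (tendsto_finsetSum Finset.univ fun x' _ => (hL x').const_mul (P x x')).congr fun n => ?_
  rw [qs_succ, Finset.mul_sum]
  exact Finset.sum_congr rfl fun x' _ => by ring

theorem qs_bound [Fintype X] {P : X → X → ℝ} {f u w : X → ℝ} {M l : ℝ} (hP : ∀ x x', 0 ≤ P x x')
    (hrow : ∀ x, ∑ x', P x x' = 1)
    (hf : ∀ x, |f x| ≤ M) (hu : ∀ x, |u x| ≤ M) (hw : ∀ x, |w x| ≤ M) (hM : 1 ≤ M) (hl : 0 < l)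
    (e1 : ∀ x, ∑ x', P x x' * (f x' + u x') = u x)
    (e2 : ∀ x, ∑ x', P x x' * (f x' ^ 2 / 2 + f x' * u x' + w x') = w x + l) :
    ∃ c > 0, ∀ (x : X) (y : ℝ) (n : ℕ), 1 ≤ n → qs P f n x y ≤ c * (1 + max y 0) / √n := by
  obtain ⟨C, hC, θ₀, hθ₀, H⟩ := Gam_bound hP hrow hf hu hw hM hl e1 e2
  obtain ⟨E, hE⟩ : ∃ E, E = Real.exp (-(l * θ₀ ^ 2)) := ⟨_, rfl⟩
  have hE0 : 0 < E := hE ▸ Real.exp_pos _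
  refine ⟨2 * C / (θ₀ * E), by positivity, fun x y n hn => ?_⟩
  have hn' : (1 : ℝ) ≤ n := by exact_mod_cast hn
  have hs1 : 1 ≤ √(n : ℝ) := Real.one_le_sqrt.2 hn'
  have hss : √(n : ℝ) * √n = n := Real.mul_self_sqrt (by linarith)
  have hm : 0 ≤ max y 0 := le_max_right _ _
  have hmy : y ≤ max y 0 + 1 := by linarith [le_max_left y 0]
  refine (qs_mono_y hP n x y _ hmy).trans ?_
  generalize max y 0 = m at *
  have hb := (H (θ₀ / √n) (by positivity) (div_le_self hθ₀.le hs1) x (m + 1) (by linarith)).1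
  have hδ : l * (θ₀ / √n) ^ 2 = l * θ₀ ^ 2 / n := by
    rw [div_pow, Real.sq_sqrt (by linarith)]; ring
  rw [hδ] at hb
  have hlow : (n : ℝ) * (qs P f n x (m + 1) * E) ≤ Gam P f (l * θ₀ ^ 2 / n) x (m + 1) := by
    have h1 : ∑ k ∈ range n, qs P f k x (m + 1) * Real.exp (-(l * θ₀ ^ 2 / n * k)) ≤ Gam P f (l * θ₀ ^ 2 / n) x (m + 1) :=
      (Gam_summable hP hrow (by positivity) x (m + 1)).sum_le_tsum _
        fun k _ => mul_nonneg (qs_nonneg hP k x _) (Real.exp_pos _).le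
    refine le_trans ?_ h1
    have h2 : ∑ k ∈ range n, qs P f n x (m + 1) * E = (n : ℝ) * (qs P f n x (m + 1) * E) := by simp
    rw [← h2]
    refine Finset.sum_le_sum fun k hk => ?_
    have hk' : k ≤ n := (Finset.mem_range.1 hk).le
    refine mul_le_mul (qs_antitone hP hrow x _ hk') ?_ hE0.le (qs_nonneg hP k x _)
    rw [hE, Real.exp_le_exp, neg_le_neg_iff, div_mul_eq_mul_div, div_le_iff₀ (by linarith)]
    have : (k : ℝ) ≤ n := by exact_mod_cast hk'
    gcongr
  generalize qs P f n x (m + 1) = q at *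
  generalize Gam P f (l * θ₀ ^ 2 / n) x (m + 1) = G at *
  have h3 : θ₀ / √n * (n * (q * E)) ≤ C * (1 + (m + 1)) := le_trans (by gcongr) hb
  have h4 : θ₀ / √n * (n * (q * E)) = q * √n * (θ₀ * E) := by
    have hs0 : √(n : ℝ) ≠ 0 := by positivity
    calc θ₀ / √n * (n * (q * E)) = θ₀ / √n * (√n * √n * (q * E)) := by rw [hss]
      _ = q * √n * (θ₀ * E) := by field_simp
  rw [h4] at h3
  rw [le_div_iff₀ (by linarith), div_mul_eq_mul_div, le_div_iff₀ (by positivity)]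
  nlinarith

theorem kpow_nonneg [Fintype X] [DecidableEq X] {P : X → X → ℝ} (hP : ∀ x x', 0 ≤ P x x') (n : ℕ) :
    ∀ x x', 0 ≤ kpow P n x x' := by
  induction n with
  | zero => intro x x'; unfold kpow; split_ifs <;> simp
  | succ n ih =>
    intro x x'
    exact Finset.sum_nonneg fun y _ => mul_nonneg (hP _ _) (ih _ _)

theorem kpow_fix [Fintype X] [DecidableEq X] {P : X → X → ℝ} {h : X → ℝ}
    (hh : ∀ x, ∑ x', P x x' * h x' = h x) (n : ℕ) : ∀ x, ∑ x', kpow P n x x' * h x' = h x := by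
  induction n with
  | zero => intro x; simp [kpow]
  | succ n ih =>
    intro x
    simp only [kpow, Finset.sum_mul]
    rw [Finset.sum_comm]
    simp_rw [mul_assoc, ← Finset.mul_sum, ih]
    exact hh x

theorem harmonic_const [Fintype X] [DecidableEq X] [Nonempty X] {P : X → X → ℝ}
    (hrow : ∀ x, ∑ x', P x x' = 1) (h1 : Primitive P) (h : X → ℝ)
    (hh : ∀ x, ∑ x', P x x' * h x' = h x) : ∀ x x', h x = h x' := by
  obtain ⟨k, _, hk⟩ := h1
  obtain ⟨m, hm⟩ := Finite.exists_max h
  have hone : ∀ x, ∑ x', kpow P k x x' * 1 = 1 :=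
    kpow_fix (h := fun _ => (1 : ℝ)) (fun x => by simpa using hrow x) k
  have hz : ∑ x', kpow P k m x' * (h m - h x') = 0 := by
    have e := kpow_fix hh k m
    have e2 := hone m
    simp only [mul_one] at e2
    simp only [mul_sub, Finset.sum_sub_distrib]
    rw [← Finset.sum_mul, e2, e]; ring
  have hall := (Finset.sum_eq_zero_iff_of_nonneg
    (fun x' _ => mul_nonneg (hk m x').le (sub_nonneg.2 (hm x')))).1 hz
  have : ∀ x', h x' = h m := by
    intro x'
    have := hall x' (Finset.mem_univ _)
    rcases mul_eq_zero.1 this with h5 | h5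
    · exact absurd h5 (hk m x').ne'
    · linarith
  intro x x'
  rw [this x, this x']

theorem nu_Pop [Fintype X] {P : X → X → ℝ} {ν : X → ℝ} (nuInv : ∀ x', ∑ x, ν x * P x x' = ν x') (g : X → ℝ) :
    ∑ x, ν x * ∑ x', P x x' * g x' = ∑ x, ν x * g x := by
  simp_rw [Finset.mul_sum]
  rw [Finset.sum_comm]
  refine Finset.sum_congr rfl fun x' _ => ?_
  rw [← nuInv x', Finset.sum_mul]
  exact Finset.sum_congr rfl fun x _ => by ring

theorem l_pos [Fintype X] {P : X → X → ℝ} {ν f u : X → ℝ} (hS : IsStochastic P ν) (h3 : NonLattice P f)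
    (e1 : ∀ x, ∑ x', P x x' * (f x' + u x') = u x) :
    0 < ∑ x, ν x * (f x ^ 2 / 2 + f x * u x) := by
  have key : 2 * ∑ x, ν x * (f x ^ 2 / 2 + f x * u x) =
      ∑ x, ν x * ∑ x', P x x' * (f x' + u x' - u x) ^ 2 := by
    have hin : ∀ x, ∑ x', P x x' * (f x' + u x' - u x) ^ 2 =
        ∑ x', P x x' * (f x' + u x') ^ 2 - u x ^ 2 := by
      intro x
      have : ∀ x', P x x' * (f x' + u x' - u x) ^ 2 =
          P x x' * (f x' + u x') ^ 2 - 2 * u x * (P x x' * (f x' + u x')) + u x ^ 2 * P x x' := by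
        intro x'; ring
      simp_rw [this]
      rw [Finset.sum_add_distrib, Finset.sum_sub_distrib, ← Finset.mul_sum, ← Finset.mul_sum, e1, hS.rowSum]
      ring
    simp_rw [hin, mul_sub]
    rw [Finset.sum_sub_distrib, nu_Pop hS.nuInv (fun x' => (f x' + u x') ^ 2), Finset.mul_sum,
      ← Finset.sum_sub_distrib]
    exact Finset.sum_congr rfl fun x _ => by ring
  have hterm : ∀ x, 0 ≤ ∑ x', P x x' * (f x' + u x' - u x) ^ 2 := fun x =>
    Finset.sum_nonneg fun x' _ => mul_nonneg (hS.nonneg _ _) (sq_nonneg _)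
  have hnn : 0 ≤ ∑ x, ν x * ∑ x', P x x' * (f x' + u x' - u x) ^ 2 :=
    Finset.sum_nonneg fun x _ => mul_nonneg (hS.nuPos x).le (hterm x)
  rcases hnn.lt_or_eq with hlt | heq
  · linarith
  exfalso
  have hz : ∀ x x', 0 < P x x' → f x' = u x - u x' := by
    intro x x' hp
    have h1 := (Finset.sum_eq_zero_iff_of_nonneg
      (fun x _ => mul_nonneg (hS.nuPos x).le (hterm x))).1 heq.symm x (Finset.mem_univ _)
    have h2 := (mul_eq_zero.1 h1).resolve_left (hS.nuPos x).ne'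
    have h3 := (Finset.sum_eq_zero_iff_of_nonneg
      (fun x' _ => mul_nonneg (hS.nonneg _ _) (sq_nonneg _))).1 h2 x' (Finset.mem_univ _)
    have h4 := (mul_eq_zero.1 h3).resolve_left hp.ne'
    have h5 := pow_eq_zero_iff (two_ne_zero) |>.1 h4
    linarith
  obtain ⟨n, g, hg, hne⟩ := h3 0 0
  apply hne 0
  have hpos : ∀ i, 0 < P (g i) (g (i + 1)) := fun i =>
    lt_of_le_of_ne (hS.nonneg _ _) fun h0 => hg.ne' (Finset.prod_eq_zero (Finset.mem_univ i) h0.symm)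
  have hs1 : ∑ i, f (g (i + 1)) = ∑ i, f (g i) := Equiv.sum_comp (Equiv.addRight (1 : Fin (n + 1))) (fun i => f (g i))
  have hs2 : ∑ i, u (g (i + 1)) = ∑ i, u (g i) := Equiv.sum_comp (Equiv.addRight (1 : Fin (n + 1))) (fun i => u (g i))
  have : ∑ i, f (g (i + 1)) = ∑ i, (u (g i) - u (g (i + 1))) :=
    Finset.sum_congr rfl fun i _ => hz _ _ (hpos i)
  rw [Finset.sum_sub_distrib, hs2, hs1] at this
  rw [this]; simp

theorem exists_data [Fintype X] [DecidableEq X] [Nonempty X] {P : X → X → ℝ} {ν f : X → ℝ}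
    (hS : IsStochastic P ν) (h1 : Primitive P) (h2 : ∑ x, f x * ν x = 0) (h3 : NonLattice P f) :
    ∃ (u w : X → ℝ) (M l : ℝ), (∀ x, |f x| ≤ M) ∧ (∀ x, |u x| ≤ M) ∧ (∀ x, |w x| ≤ M) ∧ 1 ≤ M ∧ 0 < l ∧
      (∀ x, ∑ x', P x x' * (f x' + u x') = u x) ∧
      (∀ x, ∑ x', P x x' * (f x' ^ 2 / 2 + f x' * u x' + w x') = w x + l) := by
  have hc := harmonic_const hS.rowSum h1
  obtain ⟨u, hu⟩ := poisson P ν hc hS.nuSum hS.nuInv (fun x => ∑ x', P x x' * f x') (by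
    rw [nu_Pop hS.nuInv, ← h2]; exact Finset.sum_congr rfl fun x _ => mul_comm _ _)
  have e1 : ∀ x, ∑ x', P x x' * (f x' + u x') = u x := by
    intro x
    simp_rw [mul_add]
    rw [Finset.sum_add_distrib]
    linarith [hu x]
  have hl := l_pos hS h3 e1
  obtain ⟨l, hle⟩ : ∃ l, l = ∑ x, ν x * (f x ^ 2 / 2 + f x * u x) := ⟨_, rfl⟩
  rw [← hle] at hl
  obtain ⟨w, hw⟩ := poisson P ν hc hS.nuSum hS.nuInv
    (fun x => ∑ x', P x x' * (f x' ^ 2 / 2 + f x' * u x') - l) (by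
    simp_rw [mul_sub]
    rw [Finset.sum_sub_distrib, nu_Pop hS.nuInv (fun x' => f x' ^ 2 / 2 + f x' * u x'), ← Finset.sum_mul, hS.nuSum, hle]
    ring)
  have hb : ∀ g : X → ℝ, ∀ x, |g x| ≤ ∑ x, |g x| := fun g x =>
    Finset.single_le_sum (f := fun x => |g x|) (fun x _ => abs_nonneg _) (Finset.mem_univ x)
  have hn : ∀ g : X → ℝ, 0 ≤ ∑ x, |g x| := fun g => Finset.sum_nonneg fun x _ => abs_nonneg _
  refine ⟨u, w, 1 + ∑ x, |f x| + ∑ x, |u x| + ∑ x, |w x|, l, ?_, ?_, ?_, ?_, hl, e1, ?_⟩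
  · intro x; linarith [hb f x, hn f, hn u, hn w]
  · intro x; linarith [hb u x, hn f, hn u, hn w]
  · intro x; linarith [hb w x, hn f, hn u, hn w]
  · linarith [hn f, hn u, hn w]
  · intro x
    have e : ∀ x', P x x' * (f x' ^ 2 / 2 + f x' * u x' + w x') =
        P x x' * (f x' ^ 2 / 2 + f x' * u x') + P x x' * w x' := fun x' => by ring
    simp_rw [e]
    rw [Finset.sum_add_distrib]
    linarith [hw x]

/-- Proposition 2.2: asymptotics of the survival probability. -/
theorem survival_probability_asymptotics [Fintype X] [DecidableEq X] [Nonempty X]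
    (P : X → X → ℝ) (ν f : X → ℝ) (hS : IsStochastic P ν)
    (h1 : Primitive P) (h2 : ∑ x, f x * ν x = 0) (h3 : NonLattice P f) :
    (∃ V : X → ℝ → ℝ, ∀ (x : X) (y : ℝ), 0 ≤ V x y ∧
      Tendsto (fun n : ℕ =>
          Real.sqrt (sigma2 P ν f) * Real.sqrt (2 * π * n) / 2 *
            Ex P x n (fun ω => ind (survives f y n ω)))
        atTop (nhds (V x y))) ∧
    (∃ c > 0, ∀ (x : X) (y : ℝ) (n : ℕ), 1 ≤ n →
      Ex P x n (fun ω => ind (survives f y n ω)) ≤ c * (1 + max y 0) / Real.sqrt n) := by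
  obtain ⟨u, w, M, l, hf, hu, hw, hM, hl, e1, e2⟩ := exists_data hS h1 h2 h3
  simp_rw [Ex_eq_qs]
  refine ⟨?_, qs_bound hS.nonneg hS.rowSum hf hu hw hM hl e1 e2⟩
  have H := qs_tendsto hS.nonneg (qs_tendsto_pos hS.nonneg hS.rowSum hf hu hw hM hl e1 e2)
  choose V hV0 hV using H
  refine ⟨fun x y => √(sigma2 P ν f) * √(2 * π) / 2 * V x y, fun x y => ⟨?_, ?_⟩⟩
  · have := hV0 x y
    positivity
  · refine ((hV x y).const_mul (√(sigma2 P ν f) * √(2 * π) / 2)).congr fun n => ?_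
    rw [Real.sqrt_mul (by positivity : (0 : ℝ) ≤ 2 * π) (n : ℝ)]
    ring
end CLLT
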